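/- arXiv:2411.11462 — 3 statements merged into one kernel-verified Lean document; each statement's English description precedes it below -/
import Mathlib

section
/- Let u,v ∈ Sⁿ, n ≥ 2, be two distinct non-antipodal points and let L_{uv} = {x ∈ Sⁿ : ⟨x,u⟩ ≤ 0 and ⟨x,v⟩ ≤ 0} be the lune bounded by the hemispheres opposite to u and v. Then the polar set of L_{uv} is the geodesic segment [u,v], and d(u,v) = π − b(L_{uv}), where b(L_{uv}) is the breadth of the lune L_{uv}. -/
open scoped RealInnerProductSpace
open Real MeasureTheory

noncomputable section

namespace SphericalPal

/-- Ambient Euclidean space of the sphere `Sⁿ`. -/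
abbrev E (n : ℕ) := EuclideanSpace ℝ (Fin (n + 1))

/-- The unit sphere `Sⁿ ⊂ ℝⁿ⁺¹`. -/
def unitSphere (n : ℕ) : Set (E n) := Metric.sphere 0 1

variable {n : ℕ}

/-- Geodesic (angular) distance on the unit sphere. -/
def gdist (x y : E n) : ℝ := Real.arccos ⟪x, y⟫

/-- The geodesic segment joining `x` and `y` on the sphere. -/
def seg (x y : E n) : Set (E n) :=
  {z ∈ unitSphere n | gdist x z + gdist z y = gdist x y}

/-- A subset of the sphere is spherically convex if it lies on the sphere, is contained
in an open hemisphere and contains the geodesic segment joining any two of its points. -/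
def SConvex (X : Set (E n)) : Prop :=
  X ⊆ unitSphere n ∧
  (∃ u ∈ unitSphere n, ∀ x ∈ X, 0 < ⟪u, x⟫) ∧
  ∀ x ∈ X, ∀ y ∈ X, seg x y ⊆ X

/-- Spherical convex hull. -/
def sconv (X : Set (E n)) : Set (E n) := ⋂₀ {C | SConvex C ∧ X ⊆ C}

/-- Relative (spherical) interior of a subset of the sphere. -/
def sInterior (X : Set (E n)) : Set (E n) :=
  {x ∈ X | ∃ ε > 0, ∀ y ∈ unitSphere n, gdist x y < ε → y ∈ X}

/-- A spherical convex body: compact, spherically convex, with nonempty relative interior. -/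
def IsConvexBody (K : Set (E n)) : Prop :=
  SConvex K ∧ IsCompact K ∧ (sInterior K).Nonempty

/-- The lune determined by `u` and `v` (intersection of the closed hemispheres
opposite to `u` and to `v`). -/
def lune (u v : E n) : Set (E n) := {x ∈ unitSphere n | ⟪x, u⟫ ≤ 0 ∧ ⟪x, v⟫ ≤ 0}

/-- The bounding hemisphere of `lune u v` contained in the great sphere orthogonal to `u`. -/
def luneFace (u v : E n) : Set (E n) := {x ∈ unitSphere n | ⟪x, u⟫ = 0 ∧ ⟪x, v⟫ ≤ 0}

/-- The center (midpoint) of the bounding hemisphere `luneFace u v`. -/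
def luneFaceCenter (u v : E n) : E n :=
  ‖(⟪u, v⟫ • u - v : E n)‖⁻¹ • (⟪u, v⟫ • u - v)

/-- The breadth of the lune `lune u v`: the geodesic distance of the centers of the
two bounding hemispheres. -/
def breadth (u v : E n) : ℝ := gdist (luneFaceCenter u v) (luneFaceCenter v u)

/-- `lune u v` is a supporting lune of `K`. -/
def IsSupportingLune (K : Set (E n)) (u v : E n) : Prop :=
  u ∈ unitSphere n ∧ v ∈ unitSphere n ∧ u ≠ v ∧ u ≠ -v ∧
  K ⊆ lune u v ∧ (K ∩ luneFace u v).Nonempty ∧ (K ∩ luneFace v u).Nonempty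

/-- The (minimal) width of a spherical convex body. -/
def width (K : Set (E n)) : ℝ :=
  sInf {b | ∃ u v : E n, IsSupportingLune K u v ∧ b = breadth u v}

/-- The width of `K` with respect to the supporting great hypersphere orthogonal to `u`:
the minimal breadth among supporting lunes of `K` having one bounding hemisphere
contained in that great hypersphere. -/
def widthAt (K : Set (E n)) (u : E n) : ℝ :=
  sInf {b | ∃ v : E n, IsSupportingLune K u v ∧ b = breadth u v}

/-- The great hypersphere orthogonal to `u` supports `K`. -/
def IsSupportingSphere (K : Set (E n)) (u : E n) : Prop :=
  u ∈ unitSphere n ∧ (∀ x ∈ K, ⟪x, u⟫ ≤ 0) ∧ ∃ x ∈ K, ⟪x, u⟫ = 0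

/-- `K` is of constant width `w`. -/
def HasConstantWidth (K : Set (E n)) (w : ℝ) : Prop :=
  ∀ u : E n, IsSupportingSphere K u → widthAt K u = w

/-- `K` is a reduced convex body. -/
def IsReduced (K : Set (E n)) : Prop :=
  IsConvexBody K ∧ ∀ L : Set (E n), IsConvexBody L → L ⊆ K → L ≠ K → width L < width K

/-- The spherical polar set. -/
def polar (A : Set (E n)) : Set (E n) := {u ∈ unitSphere n | ∀ a ∈ A, ⟪a, u⟫ ≤ 0}

/-- Closed geodesic ball on the sphere. -/
def gball (p : E n) (r : ℝ) : Set (E n) := {x ∈ unitSphere n | gdist p x ≤ r}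

/-- The inradius of `K`: the largest `r` such that some geodesic ball of radius `r`
is contained in `K`. -/
def inradius (K : Set (E n)) : ℝ :=
  sSup {r | 0 ≤ r ∧ ∃ p ∈ unitSphere n, gball p r ⊆ K}

/-- Geodesic distance from a point to a set. -/
def sdist (x : E n) (A : Set (E n)) : ℝ := sInf (gdist x '' A)

/-- Hausdorff distance with respect to the geodesic metric. -/
def hausdorffG (A B : Set (E n)) : ℝ :=
  max (sSup ((fun x => sdist x B) '' A)) (sSup ((fun y => sdist y A) '' B))

/-- Two subsets of the sphere are congruent, i.e., isometric by an orthogonal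
transformation of the ambient Euclidean space. -/
def Congruent (A B : Set (E n)) : Prop :=
  ∃ f : E n ≃ₗᵢ[ℝ] E n, f '' A = B

/-- Spherical surface measure on `S²` (2-dimensional Hausdorff measure). -/
def area (X : Set (E 2)) : ℝ := (μH[2] X).toReal

/-- The spherical angle `∠(x, p, y)` at `p` between the geodesic segments `[p,x]`, `[p,y]`. -/
def sangle (x p y : E 2) : ℝ :=
  InnerProductGeometry.angle (x - ⟪p, x⟫ • p) (y - ⟪p, y⟫ • p)

/-- `T` is a regular spherical triangle: the spherical convex hull of three points
with equal pairwise geodesic distances, not lying on a common great circle. -/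
def IsRegularTriangle (T : Set (E 2)) : Prop :=
  ∃ v₁ v₂ v₃ : E 2, v₁ ∈ unitSphere 2 ∧ v₂ ∈ unitSphere 2 ∧ v₃ ∈ unitSphere 2 ∧
    LinearIndependent ℝ ![v₁, v₂, v₃] ∧
    gdist v₁ v₂ = gdist v₂ v₃ ∧ gdist v₂ v₃ = gdist v₁ v₃ ∧
    T = sconv {v₁, v₂, v₃}

/-- Three points on the sphere with equal pairwise geodesic distance `a`
(the vertices of a regular spherical triangle of side length `a`). -/
def IsRegularCenters (x₁ x₂ x₃ : E 2) (a : ℝ) : Prop :=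
  x₁ ∈ unitSphere 2 ∧ x₂ ∈ unitSphere 2 ∧ x₃ ∈ unitSphere 2 ∧
  gdist x₁ x₂ = a ∧ gdist x₂ x₃ = a ∧ gdist x₁ x₃ = a

/-- `U` is a spherical Reuleaux triangle: intersection of three geodesic balls of radius `r`
whose centers have pairwise geodesic distance `r`. -/
def IsReuleaux (U : Set (E 2)) (r : ℝ) : Prop :=
  ∃ x₁ x₂ x₃ : E 2, IsRegularCenters x₁ x₂ x₃ r ∧
    U = gball x₁ r ∩ gball x₂ r ∩ gball x₃ r

/-- The body `U°_{π-w}` for `w > π/2`: the spherical convex hull of three geodesic balls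
of radius `w - π/2` (whose centers are meant to form a regular triangle of side `π - w`). -/
def polarReuleaux (x₁ x₂ x₃ : E 2) (w : ℝ) : Set (E 2) :=
  sconv (gball x₁ (w - π / 2) ∪ gball x₂ (w - π / 2) ∪ gball x₃ (w - π / 2))

end SphericalPal

open SphericalPal


theorem polar_scale {n : ℕ} {u v z : E n} (hz : z ∈ polar (lune u v)) (x : E n)
    (h1 : ⟪x, u⟫ ≤ 0) (h2 : ⟪x, v⟫ ≤ 0) : ⟪x, z⟫ ≤ 0 := by
  by_cases hx : x = 0
  · simp [hx]
  have hn : 0 < ‖x‖ := norm_pos_iff.mpr hx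
  have hi : 0 < ‖x‖⁻¹ := inv_pos.mpr hn
  have h := hz.2 (‖x‖⁻¹ • x) ⟨by
    simp [unitSphere, norm_smul, hn.ne'], by
    rw [real_inner_smul_left]; exact mul_nonpos_of_nonneg_of_nonpos hi.le h1, by
    rw [real_inner_smul_left]; exact mul_nonpos_of_nonneg_of_nonpos hi.le h2⟩
  rw [real_inner_smul_left] at h
  by_contra hc
  push Not at hc
  have := mul_pos hi hc
  linarith

/-- the polar of the lune `L_{uv}` is the geodesic segment `[u,v]`, and
`d(u,v) = π - b(L_{uv})`. -/
theorem lune_polar_and_breadth (n : ℕ) (hn : 2 ≤ n) (u v : E n)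
    (hu : u ∈ unitSphere n) (hv : v ∈ unitSphere n) (huv : u ≠ v) (huv' : u ≠ -v) :
    polar (lune u v) = seg u v ∧ gdist u v = π - breadth u v := by
  have nu : ‖u‖ = 1 := by simpa [unitSphere] using hu
  have nv : ‖v‖ = 1 := by simpa [unitSphere] using hv
  have uu : ⟪u, u⟫ = 1 := by rw [real_inner_self_eq_norm_sq, nu]; norm_num
  have vv : ⟪v, v⟫ = 1 := by rw [real_inner_self_eq_norm_sq, nv]; norm_num
  have vu : ⟪v, u⟫ = ⟪u, v⟫ := real_inner_comm _ _
  obtain ⟨c, hc⟩ : ∃ c : ℝ, ⟪u, v⟫ = c := ⟨_, rfl⟩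
  have hc1 : c < 1 := by
    have h : 0 < ⟪u - v, u - v⟫ := real_inner_self_pos.mpr (sub_ne_zero.mpr huv)
    simp only [inner_sub_left, inner_sub_right, uu, vv, vu, hc] at h
    linarith
  have hc2 : -1 < c := by
    have h : 0 < ⟪u + v, u + v⟫ := real_inner_self_pos.mpr (by
      intro h; exact huv' (eq_neg_of_add_eq_zero_left h))
    simp only [inner_add_left, inner_add_right, uu, vv, vu, hc] at h
    linarith
  have hD : 0 < 1 - c ^ 2 := by nlinarith
  refine ⟨?_, ?_⟩
  · ext z
    have key : ∀ hz : z ∈ unitSphere n, ∃ w : E n, ⟪w, u⟫ = 0 ∧ ⟪w, v⟫ = 0 ∧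
        ⟪w, z⟫ = ⟪w, w⟫ ∧ ⟪w, w⟫ * (1 - c ^ 2) = 1 - c ^ 2 - ⟪z, u⟫ ^ 2 - ⟪z, v⟫ ^ 2
          + 2 * c * ⟪z, u⟫ * ⟪z, v⟫ ∧
        z = w + ((⟪z, u⟫ - c * ⟪z, v⟫) / (1 - c ^ 2)) • u
          + ((⟪z, v⟫ - c * ⟪z, u⟫) / (1 - c ^ 2)) • v := by
      intro hz
      have nz : ‖z‖ = 1 := by simpa [unitSphere] using hz
      have zz : ⟪z, z⟫ = 1 := by rw [real_inner_self_eq_norm_sq, nz]; norm_num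
      have uz : ⟪u, z⟫ = ⟪z, u⟫ := real_inner_comm _ _
      have vz : ⟪v, z⟫ = ⟪z, v⟫ := real_inner_comm _ _
      refine ⟨z - ((⟪z, u⟫ - c * ⟪z, v⟫) / (1 - c ^ 2)) • u
          - ((⟪z, v⟫ - c * ⟪z, u⟫) / (1 - c ^ 2)) • v, ?_, ?_, ?_, ?_, by abel⟩ <;>
      · simp only [inner_sub_left, inner_sub_right, real_inner_smul_left,
          real_inner_smul_right, uu, vv, vu, hc, zz, uz, vz]
        field_simp
        ring
    constructor
    · intro hz
      obtain ⟨w, wu, wv, wz, ww, hw⟩ := key hz.1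
      have nz : ‖z‖ = 1 := by simpa [unitSphere] using hz.1
      have h0 : ⟪w, w⟫ = 0 := le_antisymm
        (wz ▸ polar_scale hz w wu.le wv.le) real_inner_self_nonneg
      have ha := polar_scale hz (c • v - u) (by
        simp only [inner_sub_left, real_inner_smul_left, uu, vv, vu, hc]; nlinarith) (by
        simp only [inner_sub_left, real_inner_smul_left, uu, vv, vu, hc]; linarith)
      have hb := polar_scale hz (c • u - v) (by
        simp only [inner_sub_left, real_inner_smul_left, uu, vv, vu, hc]; linarith) (by
        simp only [inner_sub_left, real_inner_smul_left, uu, vv, vu, hc]; nlinarith)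
      have uz : ⟪u, z⟫ = ⟪z, u⟫ := real_inner_comm _ _
      have vz : ⟪v, z⟫ = ⟪z, v⟫ := real_inner_comm _ _
      simp only [inner_sub_left, real_inner_smul_left, uz, vz] at ha hb
      refine ⟨hz.1, ?_⟩
      unfold gdist
      rw [uz, hc]
      have bp := abs_le.mp (abs_real_inner_le_norm z u)
      have bq := abs_le.mp (abs_real_inner_le_norm z v)
      rw [nz, nu] at bp
      rw [nz, nv] at bq
      generalize ⟪z, u⟫ = p at *
      generalize ⟪z, v⟫ = q at *
      rw [h0] at ww
      have hpq : 0 ≤ p + q := by nlinarith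
      have hs : arccos p + arccos q ≤ π := by
        have := arccos_le_arccos (show -q ≤ p by linarith)
        rw [arccos_neg] at this
        linarith
      rw [← arccos_cos (add_nonneg (arccos_nonneg p) (arccos_nonneg q)) hs, cos_add,
        cos_arccos (by linarith) (by linarith), cos_arccos (by linarith) (by linarith),
        sin_arccos, sin_arccos, ← sqrt_mul (by nlinarith)]
      have e : (1 - p ^ 2) * (1 - q ^ 2) = (p * q - c) ^ 2 := by linarith
      have hge : 0 ≤ p * q - c := by
        -- `(p - c q)(q - c p) ≥ 0` together with the vanishing Gram determinant
        have := mul_nonneg (show 0 ≤ p - c * q by linarith) (show 0 ≤ q - c * p by linarith)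
        have h2 : (p - c * q) * (q - c * p) = (p * q - c) * (1 - c ^ 2) := by
          linear_combination (-c) * ww
        rw [h2] at this
        exact nonneg_of_mul_nonneg_left this hD
      rw [e, sqrt_sq hge]
      congr 1
      ring
    · rintro ⟨hz, h⟩
      refine ⟨hz, ?_⟩
      obtain ⟨w, wu, wv, wz, ww, hw⟩ := key hz
      have nz : ‖z‖ = 1 := by simpa [unitSphere] using hz
      have uz : ⟪u, z⟫ = ⟪z, u⟫ := real_inner_comm _ _
      unfold gdist at h
      rw [uz, hc] at h
      have bp := abs_le.mp (abs_real_inner_le_norm z u)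
      have bq := abs_le.mp (abs_real_inner_le_norm z v)
      rw [nz, nu] at bp
      rw [nz, nv] at bq
      generalize ⟪z, u⟫ = p at *
      generalize ⟪z, v⟫ = q at *
      have hp : cos (arccos p) = p := cos_arccos (by linarith) (by linarith)
      have hq : cos (arccos q) = q := cos_arccos (by linarith) (by linarith)
      have hcc : cos (arccos c) = c := cos_arccos (by linarith) (by linarith)
      have hs1 := sin_nonneg_of_nonneg_of_le_pi (arccos_nonneg p) (arccos_le_pi p)
      have hs2 := sin_nonneg_of_nonneg_of_le_pi (arccos_nonneg q) (arccos_le_pi q)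
      have hs3 := sin_nonneg_of_nonneg_of_le_pi (arccos_nonneg c) (arccos_le_pi c)
      have t1 := sin_sq_add_cos_sq (arccos p)
      have t2 := sin_sq_add_cos_sq (arccos q)
      rw [← h, cos_add, hp, hq] at hcc
      rw [← h, sin_add, hp, hq] at hs3
      rw [hp] at t1
      rw [hq] at t2
      generalize sin (arccos p) = s at *
      generalize sin (arccos q) = t at *
      have h0 : ⟪w, w⟫ = 0 := by
        have : ⟪w, w⟫ * (1 - c ^ 2) = 0 := by
          rw [ww, ← hcc]
          have e1 : s ^ 2 = 1 - p ^ 2 := by linarith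
          have e2 : t ^ 2 = 1 - q ^ 2 := by linarith
          linear_combination (-t^2) * e1 - (1 - p^2) * e2
        exact (mul_eq_zero.mp this).resolve_right hD.ne'
      have w0 : w = 0 := inner_self_eq_zero.mp h0
      have ha : 0 ≤ p - c * q := by
        have : p - c * q = t * (s * q + p * t) := by
          rw [← hcc]; linear_combination (-p) * t2
        rw [this]; exact mul_nonneg hs2 hs3
      have hb : 0 ≤ q - c * p := by
        have : q - c * p = s * (s * q + p * t) := by
          rw [← hcc]; linear_combination (-q) * t1
        rw [this]; exact mul_nonneg hs1 hs3
      rintro x ⟨-, x1, x2⟩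
      rw [hw, w0, zero_add, inner_add_right, real_inner_smul_right, real_inner_smul_right]
      exact add_nonpos (mul_nonpos_of_nonneg_of_nonpos (div_nonneg ha hD.le) x1)
        (mul_nonpos_of_nonneg_of_nonpos (div_nonneg hb hD.le) x2)
  · have n1 : ‖(c • u - v : E n)‖ ^ 2 = 1 - c ^ 2 := by
      rw [← real_inner_self_eq_norm_sq]
      simp only [inner_sub_left, inner_sub_right, real_inner_smul_left,
          real_inner_smul_right, uu, vv, vu, hc]
      ring
    have n2 : ‖(c • v - u : E n)‖ ^ 2 = 1 - c ^ 2 := by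
      rw [← real_inner_self_eq_norm_sq]
      simp only [inner_sub_left, inner_sub_right, real_inner_smul_left,
          real_inner_smul_right, uu, vv, vu, hc]
      ring
    have n12 : ‖(c • v - u : E n)‖ = ‖(c • u - v : E n)‖ := by
      rw [← sq_eq_sq₀ (norm_nonneg _) (norm_nonneg _), n1, n2]
    have : ⟪luneFaceCenter u v, luneFaceCenter v u⟫ = -c := by
      unfold luneFaceCenter
      rw [vu, hc, n12, real_inner_smul_left, real_inner_smul_right]
      simp only [inner_sub_left, inner_sub_right, real_inner_smul_left,
          real_inner_smul_right, uu, vv, vu, hc]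
      have hne : ‖(c • u - v : E n)‖ ≠ 0 := by
        intro h; rw [h] at n1; norm_num at n1; linarith
      field_simp
      rw [n1]
      ring
    unfold breadth
    unfold gdist
    rw [this, hc, arccos_neg]
    ring
end
end

section
/- Let K ⊂ Sⁿ be a reduced convex body of width w ≥ π/2. Then K is of constant width w. -/
open scoped RealInnerProductSpace
open Real MeasureTheory

noncomputable section

open SphericalPal

namespace SphericalPal

variable {n : ℕ}

lemma mem_us {x : E n} : x ∈ unitSphere n ↔ ‖x‖ = 1 := by
  simp [unitSphere]

lemma gdist_eq_angle {x y : E n} (hx : ‖x‖ = 1) (hy : ‖y‖ = 1) :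
    gdist x y = InnerProductGeometry.angle x y := by
  simp [gdist, InnerProductGeometry.angle, hx, hy]

lemma mem_seg_of_comb {x y z : E n} (hx : ‖x‖ = 1) (hy : ‖y‖ = 1) (hz : ‖z‖ = 1)
    {α β : ℝ} (hα : 0 ≤ α) (hβ : 0 ≤ β) (h : z = α • x + β • y) : z ∈ seg x y := by
  refine ⟨mem_us.2 hz, ?_⟩
  rw [gdist_eq_angle hx hz, gdist_eq_angle hz hy, gdist_eq_angle hx hy]
  symm
  apply InnerProductGeometry.angle_eq_angle_add_add_angle_add_of_mem_span
  · intro h0; simp [h0] at hz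
  · rw [Submodule.mem_span_pair]
    exact ⟨⟨α, hα⟩, ⟨β, hβ⟩, by rw [h]; rfl⟩

lemma comb_of_mem_seg {x y z : E n} (hx : ‖x‖ = 1) (hy : ‖y‖ = 1)
    (hne : x ≠ -y) (h : z ∈ seg x y) :
    ∃ α β : ℝ, 0 ≤ α ∧ 0 ≤ β ∧ z = α • x + β • y := by
  obtain ⟨hz, h⟩ := h
  have hz := mem_us.1 hz
  rw [gdist_eq_angle hx hz, gdist_eq_angle hz hy, gdist_eq_angle hx hy] at h
  have hz0 : z ≠ 0 := by intro h0; simp [h0] at hz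
  rcases (InnerProductGeometry.angle_eq_angle_add_angle_iff hz0).1 h.symm with h1 | h1
  · exfalso
    apply hne
    rw [← inner_eq_neg_one_iff_of_norm_eq_one (𝕜 := ℝ) hx hy,
      InnerProductGeometry.inner_eq_cos_angle_of_norm_eq_one hx hy, h1, Real.cos_pi]
  · rw [Submodule.mem_span_pair] at h1
    obtain ⟨a, b, hab⟩ := h1
    exact ⟨a, b, a.2, b.2, by rw [← hab]; rfl⟩

lemma sconv_cone {K : Set (E n)} (hK : SConvex K) {x y : E n} (hx : x ∈ K) (hy : y ∈ K)
    {α β : ℝ} (hα : 0 < α) (hβ : 0 ≤ β) :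
    ∃ t : ℝ, 0 < t ∧ t • (α • x + β • y) ∈ K := by
  obtain ⟨hs, ⟨e, -, he⟩, hc⟩ := hK
  have h0 : α • x + β • y ≠ 0 := by
    intro h0
    have h1 : ⟪e, α • x + β • y⟫ = 0 := by rw [h0, inner_zero_right]
    rw [inner_add_right, real_inner_smul_right, real_inner_smul_right] at h1
    have := mul_pos hα (he x hx)
    have := mul_nonneg hβ (he y hy).le
    linarith
  have hn : 0 < ‖α • x + β • y‖ := norm_pos_iff.2 h0
  refine ⟨‖α • x + β • y‖⁻¹, inv_pos.2 hn, hc x hx y hy ?_⟩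
  refine mem_seg_of_comb (mem_us.1 (hs hx)) (mem_us.1 (hs hy)) ?_
    (α := ‖α • x + β • y‖⁻¹ * α) (β := ‖α • x + β • y‖⁻¹ * β) (by positivity) (by positivity) ?_
  · rw [norm_smul, norm_inv, norm_norm, inv_mul_cancel₀ hn.ne']
  · rw [smul_add, smul_smul, smul_smul]

lemma sconvex_inter {K : Set (E n)} (hK : SConvex K) (q : E n) :
    SConvex (K ∩ {x | ⟪x, q⟫ ≤ 0}) := by
  obtain ⟨hs, ⟨e, he1, he⟩, hc⟩ := hK
  refine ⟨fun x hx => hs hx.1, ⟨e, he1, fun x hx => he x hx.1⟩, ?_⟩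
  rintro x ⟨hx, hxq⟩ y ⟨hy, hyq⟩ z hz
  refine ⟨hc x hx y hy hz, ?_⟩
  obtain ⟨α, β, hα, hβ, rfl⟩ := comb_of_mem_seg (mem_us.1 (hs hx)) (mem_us.1 (hs hy)) (by
    rintro rfl
    have h1 := he _ hx
    have h2 := he _ hy
    rw [inner_neg_right] at h1
    linarith) hz
  simp only [Set.mem_ofPred_eq] at *
  rw [inner_add_left, real_inner_smul_left, real_inner_smul_left]
  nlinarith

lemma inner_bound {x y : E n} (hx : ‖x‖ = 1) (hy : ‖y‖ = 1) : |⟪x, y⟫| ≤ 1 := by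
  have := abs_real_inner_le_norm x y
  rwa [hx, hy, one_mul] at this

lemma interior_neg {K : Set (E n)} (hs : K ⊆ unitSphere n) {p : E n} (hp : p ∈ sInterior K)
    {v : E n} (hv : v ∈ polar K) : ⟪p, v⟫ < 0 := by
  obtain ⟨hpK, ε, hε, hy⟩ := hp
  refine lt_of_le_of_ne (hv.2 p hpK) fun h0 => ?_
  have hp1 := mem_us.1 (hs hpK)
  have hv1 := mem_us.1 hv.1
  set θ := min (ε / 2) 1 with hθ
  have hθ0 : 0 < θ := lt_min (by linarith) one_pos
  have hθ1 : θ ≤ 1 := min_le_right _ _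
  have hθε : θ < ε := lt_of_le_of_lt (min_le_left _ _) (by linarith)
  have hpi := Real.pi_gt_three
  have hpp : ⟪p, p⟫ = 1 := by rw [real_inner_self_eq_norm_sq, hp1]; norm_num
  have hvv : ⟪v, v⟫ = 1 := by rw [real_inner_self_eq_norm_sq, hv1]; norm_num
  have hvp : ⟪v, p⟫ = 0 := by rw [real_inner_comm]; exact h0
  have hmem : Real.cos θ • p + Real.sin θ • v ∈ K := by
    apply hy
    · rw [mem_us]
      have : ‖Real.cos θ • p + Real.sin θ • v‖ ^ 2 = 1 := by
        rw [← real_inner_self_eq_norm_sq]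
        simp only [inner_add_left, inner_add_right, real_inner_smul_left, real_inner_smul_right,
          hpp, hvv, hvp, h0]
        nlinarith [Real.sin_sq_add_cos_sq θ]
      nlinarith [norm_nonneg (Real.cos θ • p + Real.sin θ • v)]
    · rw [gdist, inner_add_right, real_inner_smul_right, real_inner_smul_right, hpp, h0]
      simp only [mul_one, mul_zero, add_zero]
      rw [Real.arccos_cos hθ0.le (by linarith)]
      exact hθε
  have := hv.2 _ hmem
  rw [inner_add_left, real_inner_smul_left, real_inner_smul_left, h0, hvv] at this
  have := Real.sin_pos_of_pos_of_lt_pi hθ0 (by linarith)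
  linarith

lemma interior_inter {K : Set (E n)} (hs : K ⊆ unitSphere n) {p q : E n} (hp : p ∈ sInterior K)
    (hq : ⟪p, q⟫ < 0) : p ∈ sInterior (K ∩ {x | ⟪x, q⟫ ≤ 0}) := by
  obtain ⟨hpK, ε, hε, hy⟩ := hp
  have hp1 := mem_us.1 (hs hpK)
  have hq0 : 0 < ‖q‖ + 1 := by positivity
  refine ⟨⟨hpK, hq.le⟩, min (min ε (-⟪p, q⟫ / (‖q‖ + 1))) 1,
    lt_min (lt_min hε (div_pos (by linarith) hq0)) one_pos, fun y hy1 hyd => ?_⟩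
  refine ⟨hy y hy1 (lt_of_lt_of_le hyd ((min_le_left _ _).trans (min_le_left _ _))), ?_⟩
  have hd : gdist p y < -⟪p, q⟫ / (‖q‖ + 1) :=
    lt_of_lt_of_le hyd ((min_le_left _ _).trans (min_le_right _ _))
  have hy1 := mem_us.1 hy1
  have hb := abs_le.1 (inner_bound hp1 hy1)
  have hcos : Real.cos (gdist p y) = ⟪p, y⟫ := Real.cos_arccos hb.1 hb.2
  have hd0 : 0 ≤ gdist p y := Real.arccos_nonneg _
  have h1 := Real.one_sub_sq_div_two_le_cos (x := gdist p y)
  have h2 : ‖y - p‖ ^ 2 = 2 - 2 * ⟪p, y⟫ := by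
    rw [norm_sub_sq_real, hy1, hp1, real_inner_comm]; ring
  have h3 : ‖y - p‖ ≤ gdist p y := by
    apply le_of_sq_le_sq _ hd0
    rw [h2]; linarith
  have h4 := real_inner_le_norm (y - p) q
  rw [inner_sub_left] at h4
  rw [lt_div_iff₀ hq0] at hd
  show ⟪y, q⟫ ≤ 0
  nlinarith [norm_nonneg q, norm_nonneg (y - p)]

lemma touch {K : Set (E n)} (hs : K ⊆ unitSphere n) (hc : IsCompact K) (hne : K.Nonempty)
    {u v : E n} (hu : u ∈ polar K) (hv : v ∈ polar K) (h1 : ⟪u, v⟫ < 1) (h2 : -1 < ⟪u, v⟫)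
    (hmin : ∀ u' ∈ polar K, ⟪u, v⟫ ≤ ⟪u', v⟫) : ∃ x ∈ K, ⟪x, u⟫ = 0 := by
  by_contra hcon
  push Not at hcon
  obtain ⟨x1, hx1, hmax⟩ := hc.exists_isMaxOn hne
    (f := fun x : E n => ⟪x, u⟫) (by fun_prop)
  have hx1n : ⟪x1, u⟫ < 0 := lt_of_le_of_ne (hu.2 _ hx1) (hcon _ hx1)
  set t := -⟪x1, u⟫ with ht
  have ht0 : 0 < t := by linarith
  set c := ⟪u, v⟫ with hcdef
  have hu1 := mem_us.1 hu.1
  have hv1 := mem_us.1 hv.1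
  have hN2 : ‖u - t • v‖ ^ 2 = 1 - 2 * t * c + t ^ 2 := by
    rw [norm_sub_sq_real, norm_smul, real_inner_smul_right, hu1, hv1, Real.norm_eq_abs, mul_one,
      sq_abs]
    ring
  have hNpos : 0 < ‖u - t • v‖ := by
    have : 0 < ‖u - t • v‖ ^ 2 := by rw [hN2]; nlinarith [sq_nonneg (t - c)]
    by_contra h0
    have h0' : ‖u - t • v‖ = 0 := le_antisymm (not_lt.1 h0) (norm_nonneg _)
    rw [h0'] at this
    norm_num at this
  set N := ‖u - t • v‖ with hN
  have hmem : N⁻¹ • (u - t • v) ∈ polar K := by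
    refine ⟨?_, fun x hx => ?_⟩
    · rw [mem_us, norm_smul, norm_inv, Real.norm_of_nonneg hNpos.le, ← hN,
        inv_mul_cancel₀ hNpos.ne']
    · rw [real_inner_smul_right, inner_sub_right, real_inner_smul_right]
      have ha : ⟪x, u⟫ ≤ ⟪x1, u⟫ := hmax hx
      have hb := abs_le.1 (inner_bound (mem_us.1 (hs hx)) hv1)
      apply mul_nonpos_of_nonneg_of_nonpos (by positivity)
      nlinarith
  have h3 := hmin _ hmem
  have hvv : ⟪v, v⟫ = 1 := by rw [real_inner_self_eq_norm_sq, hv1]; norm_num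
  rw [real_inner_smul_left, inner_sub_left, real_inner_smul_left, hvv, ← hcdef, mul_one,
    inv_mul_eq_div, le_div_iff₀ hNpos] at h3
  have hc2 : 0 < 1 - c ^ 2 := by nlinarith
  have key : (c * N) ^ 2 - (c - t) ^ 2 = t * (t - 2 * c) * -(1 - c ^ 2) := by
    rw [mul_pow, hN2]; ring
  rcases le_or_gt 0 c with hc0 | hc0
  · have hcN : 0 ≤ c * N := by positivity
    have : (c * N) ^ 2 ≤ (c - t) ^ 2 := by gcongr
    have h5 : 0 ≤ t * (t - 2 * c) * (1 - c ^ 2) := by nlinarith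
    have h6 : 0 ≤ t * (t - 2 * c) := nonneg_of_mul_nonneg_left h5 hc2
    have h7 : 0 ≤ t - 2 * c := nonneg_of_mul_nonneg_right h6 ht0
    linarith
  · have : (c - t) ^ 2 ≤ (c * N) ^ 2 := by
      nlinarith
    have h5 : 0 < t * (t - 2 * c) * (1 - c ^ 2) :=
      mul_pos (mul_pos ht0 (by linarith)) hc2
    nlinarith

lemma polar_compact (K : Set (E n)) : IsCompact (polar K) := by
  have : polar K = Metric.sphere 0 1 ∩ ⋂ a ∈ K, {u | ⟪a, u⟫ ≤ 0} := by
    ext u; simp [polar, unitSphere]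
  rw [this]
  refine (isCompact_sphere _ _).inter_right ?_
  exact isClosed_biInter fun a _ => isClosed_le (by fun_prop) (by fun_prop)

lemma lune_of_touch {K : Set (E n)} (hs : K ⊆ unitSphere n) {u v : E n}
    (hu : u ∈ polar K) (hv : v ∈ polar K) (h1 : ⟪u, v⟫ < 1) (h2 : -1 < ⟪u, v⟫)
    (hx : ∃ x ∈ K, ⟪x, u⟫ = 0) (hy : ∃ x ∈ K, ⟪x, v⟫ = 0) : IsSupportingLune K u v := by
  have hv1 := mem_us.1 hv.1
  refine ⟨hu.1, hv.1, ?_, ?_, fun x hx => ⟨hs hx, hu.2 x hx, hv.2 x hx⟩, ?_, ?_⟩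
  · rintro rfl
    rw [real_inner_self_eq_norm_sq, hv1] at h1; norm_num at h1
  · rintro rfl
    rw [inner_neg_left, real_inner_self_eq_norm_sq, hv1] at h2; norm_num at h2
  · obtain ⟨x, hx, h⟩ := hx
    exact ⟨x, hx, hs hx, h, hv.2 x hx⟩
  · obtain ⟨x, hx, h⟩ := hy
    exact ⟨x, hx, hs hx, h, hu.2 x hx⟩

lemma inner_lt_one {u v : E n} (hu : ‖u‖ = 1) (hv : ‖v‖ = 1) (h : u ≠ v) : ⟪u, v⟫ < 1 :=
  lt_of_le_of_ne (abs_le.1 (inner_bound hu hv)).2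
    fun h' => h ((inner_eq_one_iff_of_norm_eq_one (𝕜 := ℝ) hu hv).1 h')

lemma neg_one_lt_inner {u v : E n} (hu : ‖u‖ = 1) (hv : ‖v‖ = 1) (h : u ≠ -v) : -1 < ⟪u, v⟫ :=
  lt_of_le_of_ne (abs_le.1 (inner_bound hu hv)).1
    fun h' => h ((inner_eq_neg_one_iff_of_norm_eq_one (𝕜 := ℝ) hu hv).1 h'.symm)

lemma polar_ne_neg {K : Set (E n)} (hs : K ⊆ unitSphere n) {p : E n} (hp : p ∈ sInterior K)
    {u v : E n} (hu : u ∈ polar K) (hv : v ∈ polar K) : u ≠ -v := by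
  rintro rfl
  have h1 := interior_neg hs hp hu
  have h2 := interior_neg hs hp hv
  rw [inner_neg_right] at h1
  linarith

lemma exists_min_lune {K : Set (E n)} (hK : IsConvexBody K) {u₀ v₀ : E n}
    (hu₀ : u₀ ∈ polar K) (hv₀ : v₀ ∈ polar K) (hne : u₀ ≠ v₀) :
    ∃ u v, IsSupportingLune K u v ∧ ∀ a ∈ polar K, ∀ b ∈ polar K, ⟪u, v⟫ ≤ ⟪a, b⟫ := by
  obtain ⟨⟨hs, -, -⟩, hc, p, hp⟩ := hK
  obtain ⟨⟨u, v⟩, ⟨hu, hv⟩, hmin⟩ := ((polar_compact K).prod (polar_compact K)).exists_isMinOn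
    ⟨(u₀, v₀), hu₀, hv₀⟩ (f := fun q : E n × E n => ⟪q.1, q.2⟫) (by fun_prop)
  have hmin' : ∀ a ∈ polar K, ∀ b ∈ polar K, ⟪u, v⟫ ≤ ⟪a, b⟫ := fun a ha b hb =>
    hmin (show (a, b) ∈ polar K ×ˢ polar K from ⟨ha, hb⟩)
  have h1 : ⟪u, v⟫ < 1 := lt_of_le_of_lt (hmin' _ hu₀ _ hv₀)
    (inner_lt_one (mem_us.1 hu₀.1) (mem_us.1 hv₀.1) hne)
  have h2 : -1 < ⟪u, v⟫ :=
    neg_one_lt_inner (mem_us.1 hu.1) (mem_us.1 hv.1) (polar_ne_neg hs hp hu hv)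
  refine ⟨u, v, lune_of_touch hs hu hv h1 h2 ?_ ?_, hmin'⟩
  · exact touch hs hc ⟨p, hp.1⟩ hu hv h1 h2 fun u' hu' => hmin' _ hu' _ hv
  · rw [real_inner_comm] at h1 h2
    refine touch hs hc ⟨p, hp.1⟩ hv hu h1 h2 fun u' hu' => ?_
    rw [real_inner_comm u, real_inner_comm u]
    exact hmin' _ hu _ hu'

lemma breadth_eq {u v : E n} (hu : ‖u‖ = 1) (hv : ‖v‖ = 1) (h1 : ⟪u, v⟫ < 1)
    (h2 : -1 < ⟪u, v⟫) : breadth u v = Real.arccos (-⟪u, v⟫) := by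
  have huu : ⟪u, u⟫ = 1 := by rw [real_inner_self_eq_norm_sq, hu]; norm_num
  have hvv : ⟪v, v⟫ = 1 := by rw [real_inner_self_eq_norm_sq, hv]; norm_num
  have hn1 : ‖(⟪u, v⟫ • u - v : E n)‖ ^ 2 = 1 - ⟪u, v⟫ ^ 2 := by
    rw [norm_sub_sq_real, norm_smul, real_inner_smul_left, hu, hv, Real.norm_eq_abs, mul_one,
      sq_abs]
    ring
  have hn2 : ‖(⟪v, u⟫ • v - u : E n)‖ ^ 2 = 1 - ⟪u, v⟫ ^ 2 := by
    rw [norm_sub_sq_real, norm_smul, real_inner_smul_left, hu, hv, Real.norm_eq_abs, mul_one,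
      sq_abs, real_inner_comm u v]
    ring
  have heq : ‖(⟪v, u⟫ • v - u : E n)‖ = ‖(⟪u, v⟫ • u - v : E n)‖ := by
    rw [← sq_eq_sq₀ (norm_nonneg _) (norm_nonneg _), hn1, hn2]
  have hpos : 0 < 1 - ⟪u, v⟫ ^ 2 := by nlinarith
  rw [breadth, gdist, luneFaceCenter, luneFaceCenter, heq, real_inner_smul_left,
    real_inner_smul_right, ← mul_assoc, ← mul_inv, ← sq, hn1]
  congr 1
  simp only [inner_sub_left, inner_sub_right, real_inner_smul_left, real_inner_smul_right, huu,
    hvv, real_inner_comm u v]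
  field_simp
  ring

lemma farkas {K : Set (E n)} (hK : SConvex K) {p q a : E n} (hp : p ∈ K) (hpq : ⟪p, q⟫ < 0)
    (ha : ∀ x ∈ K, ⟪x, q⟫ ≤ 0 → ⟪x, a⟫ ≤ 0) :
    ∃ s : ℝ, 0 ≤ s ∧ ∀ x ∈ K, ⟪x, a - s • q⟫ ≤ 0 := by
  set S : Set ℝ := {r | r = 0 ∨ ∃ x ∈ K, 0 < ⟪x, q⟫ ∧ r = ⟪x, a⟫ / ⟪x, q⟫} with hS
  have hub : ∀ y ∈ K, ⟪y, q⟫ < 0 → ∀ r ∈ S, r ≤ ⟪y, a⟫ / ⟪y, q⟫ := by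
    rintro y hy hyq r (rfl | ⟨x, hx, hxq, rfl⟩)
    · exact div_nonneg_of_nonpos (ha y hy hyq.le) hyq.le
    · obtain ⟨t, ht, hz⟩ := sconv_cone hK hx hy (α := -⟪y, q⟫) (β := ⟪x, q⟫)
        (by linarith) hxq.le
      have h := ha _ hz (by
        rw [real_inner_smul_left, inner_add_left, real_inner_smul_left, real_inner_smul_left]
        apply le_of_eq; ring)
      rw [real_inner_smul_left, inner_add_left, real_inner_smul_left, real_inner_smul_left] at h
      have h' := nonpos_of_mul_nonpos_right h ht
      rw [le_div_iff_of_neg hyq, div_mul_eq_mul_div, le_div_iff₀ hxq]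
      linarith
  have hbdd : BddAbove S := ⟨_, hub p hp hpq⟩
  have hSne : S.Nonempty := ⟨0, Or.inl rfl⟩
  refine ⟨sSup S, le_csSup hbdd (Or.inl rfl), fun x hx => ?_⟩
  rw [inner_sub_right, real_inner_smul_right]
  rcases lt_trichotomy ⟪x, q⟫ 0 with h | h | h
  · have := csSup_le hSne (hub x hx h)
    rw [le_div_iff_of_neg h] at this
    linarith
  · rw [h]; have := ha x hx h.le; linarith
  · have := le_csSup hbdd (show ⟪x, a⟫ / ⟪x, q⟫ ∈ S from Or.inr ⟨x, hx, h, rfl⟩)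
    rw [div_le_iff₀ h] at this
    linarith

/-- Homogeneous version of a lower bound on inner products with the polar set. -/
lemma homog {K : Set (E n)} {z : E n} {m : ℝ} (h : ∀ v ∈ polar K, m ≤ ⟪z, v⟫)
    {y : E n} (hy : ∀ x ∈ K, ⟪x, y⟫ ≤ 0) : m * ‖y‖ ≤ ⟪z, y⟫ := by
  rcases eq_or_ne y 0 with rfl | h0
  · simp
  have hn : 0 < ‖y‖ := norm_pos_iff.2 h0
  have := h (‖y‖⁻¹ • y) ⟨by
    rw [mem_us, norm_smul, norm_inv, norm_norm, inv_mul_cancel₀ hn.ne'], fun x hx => by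
    rw [real_inner_smul_right]
    exact mul_nonpos_of_nonneg_of_nonpos (by positivity) (hy x hx)⟩
  rwa [real_inner_smul_right, inv_mul_eq_div, le_div_iff₀ hn] at this

lemma polar_inter_bound {K : Set (E n)} (hK : SConvex K) {p q : E n} (hp : p ∈ K)
    (hpq : ⟪p, q⟫ < 0) {c : ℝ} (hc : 0 ≤ c) (h1 : ∀ a ∈ polar K, ∀ b ∈ polar K, c ≤ ⟪a, b⟫)
    (hc1 : c ≤ 1) (h2 : ∀ v ∈ polar K, c * ‖q‖ ≤ ⟪q, v⟫) {a b : E n}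
    (ha : a ∈ polar (K ∩ {x | ⟪x, q⟫ ≤ 0})) (hb : b ∈ polar (K ∩ {x | ⟪x, q⟫ ≤ 0})) :
    c ≤ ⟪a, b⟫ := by
  obtain ⟨s, hs, hsa⟩ := farkas hK hp hpq (a := a) fun x hx hxq => ha.2 x ⟨hx, hxq⟩
  obtain ⟨t, ht, htb⟩ := farkas hK hp hpq (a := b) fun x hx hxq => hb.2 x ⟨hx, hxq⟩
  have ha1 := mem_us.1 ha.1
  have hb1 := mem_us.1 hb.1
  set a' := a - s • q with ha'
  set b' := b - t • q with hb'
  have hab : c * ‖a'‖ * ‖b'‖ ≤ ⟪a', b'⟫ := by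
    apply homog _ htb
    intro v hv
    rw [real_inner_comm]
    refine homog (fun u hu => ?_) hsa
    exact h1 _ hv _ hu
  have hqa := homog h2 hsa
  have hqb := homog h2 htb
  have hqq : c * ‖q‖ ^ 2 ≤ ⟪q, q⟫ := by
    rw [real_inner_self_eq_norm_sq]; nlinarith [sq_nonneg ‖q‖]
  have ea : a = a' + s • q := by rw [ha']; abel
  have eb : b = b' + t • q := by rw [hb']; abel
  have na : 1 ≤ ‖a'‖ + s * ‖q‖ := by
    have := norm_add_le a' (s • q)
    rwa [← ea, ha1, norm_smul, Real.norm_of_nonneg hs] at this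
  have nb : 1 ≤ ‖b'‖ + t * ‖q‖ := by
    have := norm_add_le b' (t • q)
    rwa [← eb, hb1, norm_smul, Real.norm_of_nonneg ht] at this
  have hprod : 1 ≤ (‖a'‖ + s * ‖q‖) * (‖b'‖ + t * ‖q‖) := one_le_mul_of_one_le_of_one_le na nb
  have e : ⟪a, b⟫ = ⟪a', b'⟫ + t * ⟪q, a'⟫ + s * ⟪q, b'⟫ + s * t * ⟪q, q⟫ := by
    conv_lhs => rw [ea, eb]
    simp only [inner_add_left, inner_add_right, real_inner_smul_left, real_inner_smul_right]
    rw [real_inner_comm a' q]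
    ring
  have e1 := mul_le_mul_of_nonneg_left hqa ht
  have e2 := mul_le_mul_of_nonneg_left hqb hs
  have e3 := mul_le_mul_of_nonneg_left hqq (mul_nonneg hs ht)
  have e4 := mul_le_mul_of_nonneg_left hprod hc
  rw [e]
  linarith

end SphericalPal

/-- Lassak: a reduced spherical convex body of width `w ≥ π/2` is of
constant width `w`. -/
theorem reduced_is_constant_width (n : ℕ) (K : Set (E n)) (w : ℝ) (hw : π / 2 ≤ w)
    (hK : IsReduced K) (hKw : width K = w) : HasConstantWidth K w := by
  obtain ⟨hB, hred⟩ := hK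
  obtain ⟨hS, hcomp, p, hp⟩ := id hB
  have hs := hS.1
  have hpi := Real.pi_pos
  have hw0 : 0 < w := by linarith
  -- every supporting lune has breadth at least the width
  have hlb : ∀ u v : E n, IsSupportingLune K u v → w ≤ breadth u v := by
    intro u v h
    rw [← hKw]
    exact csInf_le ⟨0, by rintro _ ⟨u, v, -, rfl⟩; exact Real.arccos_nonneg _⟩ ⟨u, v, h, rfl⟩
  have hmp : ∀ (L : Set (E n)) (u v : E n), IsSupportingLune L u v → u ∈ polar L ∧ v ∈ polar L :=
    fun L u v h => ⟨⟨h.1, fun x hx => (h.2.2.2.2.1 hx).2.1⟩,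
      ⟨h.2.1, fun x hx => (h.2.2.2.2.1 hx).2.2⟩⟩
  have hbr : ∀ (L : Set (E n)) (u v : E n), IsSupportingLune L u v →
      breadth u v = Real.arccos (-⟪u, v⟫) := fun L u v h =>
    breadth_eq (mem_us.1 h.1) (mem_us.1 h.2.1)
      (inner_lt_one (mem_us.1 h.1) (mem_us.1 h.2.1) h.2.2.1)
      (neg_one_lt_inner (mem_us.1 h.1) (mem_us.1 h.2.1) h.2.2.2.1)
  have hne : {b | ∃ u v : E n, IsSupportingLune K u v ∧ b = breadth u v}.Nonempty := by
    by_contra h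
    rw [Set.not_nonempty_iff_eq_empty] at h
    rw [width, h, Real.sInf_empty] at hKw
    linarith
  obtain ⟨_, u₀, v₀, hl₀, -⟩ := hne
  obtain ⟨hu₀, hv₀⟩ := hmp _ _ _ hl₀
  obtain ⟨u₁, v₁, hl₁, hmin⟩ := exists_min_lune hB hu₀ hv₀ hl₀.2.2.1
  obtain ⟨hu₁, hv₁⟩ := hmp _ _ _ hl₁
  have hc1 : ⟪u₁, v₁⟫ < 1 := inner_lt_one (mem_us.1 hl₁.1) (mem_us.1 hl₁.2.1) hl₁.2.2.1
  have hcm1 : -1 < ⟪u₁, v₁⟫ := neg_one_lt_inner (mem_us.1 hl₁.1) (mem_us.1 hl₁.2.1) hl₁.2.2.2.1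
  set c := ⟪u₁, v₁⟫ with hc
  -- the width is attained
  have hwc : w = Real.arccos (-c) := by
    apply le_antisymm
    · rw [hc, ← hbr _ _ _ hl₁]; exact hlb _ _ hl₁
    · rw [← hKw]
      refine le_csInf ⟨_, u₀, v₀, hl₀, rfl⟩ ?_
      rintro _ ⟨u, v, h, rfl⟩
      obtain ⟨hu, hv⟩ := hmp _ _ _ h
      rw [hbr _ _ _ h]
      exact Real.antitone_arccos (neg_le_neg (hmin _ hu _ hv))
  have hc0 : 0 ≤ c := by
    have h1 : Real.cos w ≤ 0 := Real.cos_nonpos_of_pi_div_two_le_of_le hw (by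
      rw [hwc]; linarith [Real.arccos_le_pi (-c)])
    rw [hwc, Real.cos_arccos (by linarith) (by linarith)] at h1
    linarith
  intro u hu
  have hup : u ∈ polar K := ⟨hu.1, hu.2.1⟩
  obtain ⟨x₀, hx₀, hx₀u⟩ := hu.2.2
  have hu1 := mem_us.1 hu.1
  have hx1 := mem_us.1 (hs hx₀)
  obtain ⟨v, hv, hvmin⟩ := (polar_compact K).exists_isMinOn ⟨u, hup⟩
    (f := fun v : E n => ⟪u, v⟫) (by fun_prop)
  have hcle : c ≤ ⟪u, v⟫ := hmin _ hup _ hv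
  rcases hcle.eq_or_lt with heq | hlt
  · -- a lune at `u` attains the width
    have hl : IsSupportingLune K u v := by
      refine lune_of_touch hs hup hv (by linarith) (by linarith) ⟨x₀, hx₀, hx₀u⟩ ?_
      have e : ⟪v, u⟫ = c := by rw [real_inner_comm]; exact heq.symm
      exact touch hs hcomp ⟨p, hp.1⟩ hv hup (by linarith) (by linarith) fun u' hu' => by
        rw [e]; exact hmin _ hu' _ hup
    have hb : breadth u v = w := by rw [hbr _ _ _ hl, ← heq, hwc]
    apply le_antisymm
    · rw [← hb]
      exact csInf_le ⟨0, by rintro _ ⟨v, -, rfl⟩; exact Real.arccos_nonneg _⟩ ⟨v, hl, rfl⟩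
    · refine le_csInf ⟨_, v, hl, rfl⟩ ?_
      rintro _ ⟨v', hlv, rfl⟩
      exact hlb _ _ hlv
  · -- otherwise cut `K` by a nearby hemisphere
    exfalso
    set m := ⟪u, v⟫ with hm
    have hpu := interior_neg hs hp hup
    set ε := min ((m - c) / 2) (-⟪p, u⟫ / 2) with hε
    have hε0 : 0 < ε := lt_min (by linarith) (by linarith)
    have hε1 : ε ≤ (m - c) / 2 := min_le_left _ _
    have hε2 : ε ≤ -⟪p, u⟫ / 2 := min_le_right _ _
    set q := u + ε • x₀ with hq
    have hpq : ⟪p, q⟫ < 0 := by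
      rw [hq, inner_add_right, real_inner_smul_right]
      have := abs_le.1 (inner_bound (mem_us.1 (hs hp.1)) hx1)
      nlinarith
    have hqn : ‖q‖ ≤ 1 + ε := by
      have := norm_add_le u (ε • x₀)
      rwa [norm_smul, hu1, hx1, Real.norm_of_nonneg hε0.le, mul_one] at this
    have hqv : ∀ v' ∈ polar K, c * ‖q‖ ≤ ⟪q, v'⟫ := by
      intro v' hv'
      have h1 : m ≤ ⟪u, v'⟫ := hvmin hv'
      have h2 := abs_le.1 (inner_bound hx1 (mem_us.1 hv'.1))
      rw [hq, inner_add_left, real_inner_smul_left, ← hq]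
      nlinarith
    have hL : IsConvexBody (K ∩ {x | ⟪x, q⟫ ≤ 0}) :=
      ⟨sconvex_inter hS q, hcomp.inter_right (isClosed_le (by fun_prop) (by fun_prop)),
        p, interior_inter hs hp hpq⟩
    have hLne : K ∩ {x | ⟪x, q⟫ ≤ 0} ≠ K := by
      intro h
      have h1 : x₀ ∈ K ∩ {x | ⟪x, q⟫ ≤ 0} := by rw [h]; exact hx₀
      have h2 : ⟪x₀, q⟫ ≤ 0 := h1.2
      rw [hq, inner_add_right, real_inner_smul_right, hx₀u, real_inner_self_eq_norm_sq, hx1] at h2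
      norm_num at h2
      linarith
    have hlt' := hred _ hL Set.inter_subset_left hLne
    rw [hKw] at hlt'
    have hsub : polar K ⊆ polar (K ∩ {x | ⟪x, q⟫ ≤ 0}) := fun y hy =>
      ⟨hy.1, fun x hx => hy.2 x hx.1⟩
    obtain ⟨u₂, v₂, hl₂, -⟩ := exists_min_lune hL (hsub hu₀) (hsub hv₀) hl₀.2.2.1
    have : w ≤ width (K ∩ {x | ⟪x, q⟫ ≤ 0}) := by
      refine le_csInf ⟨_, u₂, v₂, hl₂, rfl⟩ ?_
      rintro _ ⟨a, b, h, rfl⟩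
      obtain ⟨ha, hb⟩ := hmp _ _ _ h
      rw [hbr _ _ _ h, hwc]
      exact Real.antitone_arccos (neg_le_neg
        (polar_inter_bound hS hp.1 hpq hc0 hmin hc1.le hqv ha hb))
    linarith
end
end

section
/- Let K ⊊ Sⁿ be a convex body. Then K is of constant width w if and only if the polar body K° is of constant width π − w. -/
open scoped RealInnerProductSpace
open Real MeasureTheory

noncomputable section

open SphericalPal

/-- A pair of mutually polar sets, each having an interior point. -/
structure DPair {n : ℕ} (C K : Set (E n)) : Prop where
  hC : C = polar K
  hK : K = polar C
  ha : ∃ a ∈ C, ∀ x ∈ K, ⟪x, a⟫ < 0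
  hb : ∃ b ∈ K, ∀ u ∈ C, ⟪u, b⟫ < 0

namespace DPair

variable {n : ℕ} {C K : Set (E n)}

theorem symm (h : DPair C K) : DPair K C := ⟨h.hK, h.hC, h.hb, h.ha⟩

theorem norm_one (h : DPair C K) {u : E n} (hu : u ∈ C) : ‖u‖ = 1 := by
  rw [h.hC] at hu
  simpa [unitSphere] using hu.1

theorem inner_self (h : DPair C K) {u : E n} (hu : u ∈ C) : ⟪u, u⟫ = 1 := by
  rw [real_inner_self_eq_norm_sq, h.norm_one hu]; norm_num

theorem nonpos (h : DPair C K) {u x : E n} (hu : u ∈ C) (hx : x ∈ K) : ⟪x, u⟫ ≤ 0 := by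
  rw [h.hC] at hu
  exact hu.2 x hx

theorem mem_of (h : DPair C K) {u : E n} (h1 : ‖u‖ = 1) (h2 : ∀ x ∈ K, ⟪x, u⟫ ≤ 0) : u ∈ C := by
  rw [h.hC]
  exact ⟨by simpa [unitSphere] using h1, h2⟩

theorem mem_normalize (h : DPair C K) {u : E n} (h1 : u ≠ 0) (h2 : ∀ x ∈ K, ⟪x, u⟫ ≤ 0) :
    ‖u‖⁻¹ • u ∈ C := by
  apply h.mem_of
  · rw [norm_smul, norm_inv, norm_norm, inv_mul_cancel₀ (norm_ne_zero_iff.2 h1)]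
  · intro x hx
    rw [inner_smul_right]
    exact mul_nonpos_of_nonneg_of_nonpos (by positivity) (h2 x hx)

theorem compact (h : DPair C K) : IsCompact C := by
  have : C = Metric.sphere (0 : E n) 1 ∩ ⋂ x ∈ K, {u | ⟪x, u⟫ ≤ 0} := by
    conv_lhs => rw [h.hC]
    ext u
    simp [polar, unitSphere]
  rw [this]
  apply (isCompact_sphere _ _).inter_right
  refine isClosed_biInter fun x _ => ?_
  exact isClosed_le (by fun_prop) continuous_const

/-- Inner products of points of `C` lie in `(-1, 1)` as soon as the points are distinct. -/
theorem inner_gt (h : DPair C K) {u v : E n} (hu : u ∈ C) (hv : v ∈ C) : -1 < ⟪v, u⟫ := by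
  obtain ⟨b, hb, hb'⟩ := h.hb
  have h0 : v + u ≠ 0 := by
    intro h0
    have := hb' u hu
    have := hb' v hv
    have : ⟪v + u, b⟫ < 0 := by rw [inner_add_left]; linarith
    rw [h0, inner_zero_left] at this
    exact lt_irrefl _ this
  have := real_inner_self_pos.2 h0
  rw [inner_add_left, inner_add_right, inner_add_right, h.inner_self hu, h.inner_self hv,
    real_inner_comm] at this
  have e : ⟪u, v⟫ = ⟪v, u⟫ := real_inner_comm _ _
  linarith

theorem inner_lt (h : DPair C K) {u v : E n} (hu : u ∈ C) (hv : v ∈ C) (hne : v ≠ u) :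
    ⟪v, u⟫ < 1 := by
  have := real_inner_self_pos.2 (sub_ne_zero.2 hne)
  rw [inner_sub_left, inner_sub_right, inner_sub_right, h.inner_self hu, h.inner_self hv] at this
  have e : ⟪u, v⟫ = ⟪v, u⟫ := real_inner_comm _ _
  linarith

/-- First order condition for a farthest point. -/
theorem first_order (h : DPair C K) {u v z : E n} (hu : u ∈ C) (hv : v ∈ C) (hz : z ∈ C)
    (hmin : ∀ y ∈ C, ⟪v, u⟫ ≤ ⟪y, u⟫) : ⟪v, u⟫ * ⟪z, v⟫ ≤ ⟪z, u⟫ := by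
  set t := ⟪v, u⟫ with ht
  set c := ⟪z, v⟫ with hc
  have hc1 : -1 < c := h.inner_gt hv hz
  have hc2 : c ≤ 1 := by
    have := real_inner_le_norm z v
    rwa [h.norm_one hz, h.norm_one hv, mul_one] at this
  have ht2 : t ≤ 1 := by
    have := real_inner_le_norm v u
    rwa [h.norm_one hu, h.norm_one hv, mul_one] at this
  have ht1 : -1 < t := h.inner_gt hu hv
  have key : ∀ ε : ℝ, 0 < ε → ε < 1 → t * c ≤ ⟪z, u⟫ + ε := by
    intro ε he he1
    have hN2 : ‖v + ε • z‖ ^ 2 = 1 + 2 * ε * c + ε ^ 2 := by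
      rw [norm_add_sq_real, norm_smul, h.norm_one hv, h.norm_one hz, inner_smul_right,
        real_inner_comm, Real.norm_of_nonneg he.le, ← hc]
      ring
    set N := ‖v + ε • z‖ with hN
    have hN0 : 0 ≤ N := norm_nonneg _
    have hpos : 0 < 1 + ε * c := by nlinarith
    have hc12 : c ^ 2 ≤ 1 := by nlinarith
    have lo : 1 + ε * c ≤ N := by
      apply le_of_sq_le_sq _ hN0
      rw [hN2]; nlinarith [mul_nonneg (sq_nonneg ε) (sub_nonneg.2 hc12)]
    have hi : N ≤ 1 + ε * c + ε ^ 2 := by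
      apply le_of_sq_le_sq _ (by positivity)
      rw [hN2]
      nlinarith [sq_nonneg (ε * c + ε ^ 2), mul_pos he he, sq_nonneg (ε * c)]
    have hNp : 0 < N := by linarith
    have hm : ‖v + ε • z‖⁻¹ • (v + ε • z) ∈ C := by
      apply h.mem_normalize (norm_pos_iff.1 hNp)
      intro x hx
      rw [inner_add_right, inner_smul_right]
      nlinarith [h.nonpos hv hx, h.nonpos hz hx]
    have := hmin _ hm
    rw [inner_smul_left, inner_add_left, inner_smul_left, ← hN, ← ht] at this
    simp only [conj_trivial] at this
    have h3 : t * N ≤ t + ε * ⟪z, u⟫ := by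
      have := mul_le_mul_of_nonneg_left this hNp.le
      rw [← mul_assoc, mul_inv_cancel₀ hNp.ne'] at this
      linarith
    have h4 : t * (1 + ε * c) - ε ^ 2 ≤ t * N := by
      rcases le_total 0 t with h0 | h0
      · nlinarith [mul_le_mul_of_nonneg_left lo h0]
      · nlinarith [mul_le_mul_of_nonpos_left hi h0]
    have h5 : ε * (t * c) ≤ ε * (⟪z, u⟫ + ε) := by nlinarith
    exact le_of_mul_le_mul_left h5 he
  by_contra hcon
  push Not at hcon
  have := key (min (1/2) ((t * c - ⟪z, u⟫) / 2)) (by apply lt_min <;> linarith)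
    (lt_of_le_of_lt (min_le_left _ _) (by norm_num))
  have h2 := min_le_right (1/2) ((t * c - ⟪z, u⟫) / 2)
  linarith

/-- The centre of the face at a farthest point belongs to the polar. -/
theorem center_mem (h : DPair C K) {u v : E n} (hu : u ∈ C) (hv : v ∈ C) (hne : v ≠ u)
    (hmin : ∀ y ∈ C, ⟪v, u⟫ ≤ ⟪y, u⟫) :
    (√(1 - ⟪v, u⟫ ^ 2))⁻¹ • (⟪v, u⟫ • v - u) ∈ K := by
  set t := ⟪v, u⟫ with ht
  have ht1 : -1 < t := h.inner_gt hu hv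
  have ht2 : t < 1 := h.inner_lt hu hv hne
  have hn : ‖t • v - u‖ = √(1 - t ^ 2) := by
    rw [← Real.sqrt_sq (norm_nonneg (t • v - u))]
    congr 1
    rw [norm_sub_sq_real, norm_smul, h.norm_one hu, h.norm_one hv, inner_smul_left, ← ht,
      Real.norm_eq_abs, mul_one, sq_abs]
    simp only [conj_trivial]
    ring
  rw [← hn]
  apply h.symm.mem_normalize
  · rw [← norm_pos_iff, hn]
    apply Real.sqrt_pos.2
    nlinarith
  · intro x hx
    rw [inner_sub_right, inner_smul_right]
    have := h.first_order hu hv hx hmin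
    linarith

end DPair

/-- Constant diameter of `C`, in terms of inner products. -/
def CDiam {n : ℕ} (C K : Set (E n)) (t : ℝ) : Prop :=
  ∀ u ∈ C, (∃ x ∈ K, ⟪x, u⟫ = 0) → (∀ v ∈ C, t ≤ ⟪v, u⟫) ∧ ∃ v ∈ C, ⟪v, u⟫ = t

namespace DPair

variable {n : ℕ} {C K : Set (E n)}

theorem exists_ne (h : DPair C K) {p x : E n} (hp : p ∈ C) (hx : x ∈ K) (hpx : ⟪x, p⟫ = 0) :
    ∃ a ∈ C, a ≠ p := by
  obtain ⟨a, ha, ha'⟩ := h.ha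
  refine ⟨a, ha, ?_⟩
  rintro rfl
  exact absurd hpx (ha' x hx).ne

theorem min_pair (h : DPair C K) {p x : E n} (hp : p ∈ C) (hx : x ∈ K) (hpx : ⟪x, p⟫ = 0) :
    ∃ u ∈ C, ∃ v ∈ C, v ≠ u ∧ ∀ u' ∈ C, ∀ v' ∈ C, ⟪v, u⟫ ≤ ⟪v', u'⟫ := by
  obtain ⟨a, ha, hap⟩ := h.exists_ne hp hx hpx
  obtain ⟨⟨u, v⟩, huv, hmin⟩ := (h.compact.prod h.compact).exists_isMinOn
    (f := fun q : E n × E n => ⟪q.2, q.1⟫) ⟨(p, a), hp, ha⟩ (by fun_prop)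
  have hm : ∀ u' ∈ C, ∀ v' ∈ C, ⟪v, u⟫ ≤ ⟪v', u'⟫ := fun u' hu' v' hv' =>
    hmin (a := (u', v')) ⟨hu', hv'⟩
  refine ⟨u, huv.1, v, huv.2, ?_, hm⟩
  rintro rfl
  have h1 := hm p hp a ha
  rw [h.inner_self huv.1] at h1
  exact absurd (h.inner_lt hp ha hap) (not_lt.2 h1)

theorem center_perp (h : DPair C K) {u v : E n} (hv : v ∈ C) (r : ℝ) :
    ⟪v, r • (⟪v, u⟫ • v - u)⟫ = 0 := by
  rw [inner_smul_right, inner_sub_right, inner_smul_right, h.inner_self hv]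
  ring

theorem diam_le (h : DPair C K) {t : ℝ} (hw : CDiam C K t) {p x : E n} (hp : p ∈ C) (hx : x ∈ K)
    (hpx : ⟪x, p⟫ = 0) {u v : E n} (hu : u ∈ C) (hv : v ∈ C) : t ≤ ⟪v, u⟫ := by
  obtain ⟨u0, hu0, v0, hv0, hne, hmin⟩ := h.min_pair hp hx hpx
  refine le_trans ?_ (hmin u hu v hv)
  have hc := h.center_mem hu0 hv0 hne (fun y hy => hmin u0 hu0 y hy)
  have := (hw v0 hv0 ⟨_, hc, by rw [real_inner_comm]; exact h.center_perp hv0 _⟩).1 u0 hu0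
  rwa [real_inner_comm] at this

theorem bounds (h : DPair C K) {t : ℝ} (hw : CDiam C K t) {p x : E n} (hp : p ∈ C) (hx : x ∈ K)
    (hpx : ⟪x, p⟫ = 0) : -1 < t ∧ t < 1 := by
  obtain ⟨h1, v, hv, hvt⟩ := hw p hp ⟨x, hx, hpx⟩
  obtain ⟨a, ha, hap⟩ := h.exists_ne hp hx hpx
  exact ⟨hvt ▸ h.inner_gt hp hv, lt_of_le_of_lt (h1 a ha) (h.inner_lt hp ha hap)⟩

/-- Completeness: a point within the diameter of all points of `C` is in `C`. -/
theorem complete (h : DPair C K) {t : ℝ} (ht0 : 0 ≤ t) (hw : CDiam C K t) {p x : E n}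
    (hp : p ∈ C) (hx : x ∈ K) (hpx : ⟪x, p⟫ = 0) {z : E n} (hz1 : ‖z‖ = 1)
    (hz : ∀ c ∈ C, t ≤ ⟪z, c⟫) : z ∈ C := by
  obtain ⟨ht1, ht2⟩ := h.bounds hw hp hx hpx
  obtain ⟨a, ha, ha'⟩ := h.ha
  have hat : ∀ v ∈ C, t < ⟪a, v⟫ := by
    intro v hv
    refine lt_of_le_of_ne (h.diam_le hw hp hx hpx hv ha) fun heq => ?_
    have hne : a ≠ v := by
      rintro rfl
      rw [h.inner_self ha] at heq
      exact ht2.ne heq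
    have hc := h.center_mem hv ha hne (fun y hy => by
      rw [← heq]; exact h.diam_le hw hp hx hpx hv hy)
    have := ha' _ hc
    rw [real_inner_comm, h.center_perp ha] at this
    exact lt_irrefl _ this
  by_contra hzC
  have : ∃ y ∈ K, 0 < ⟪y, z⟫ := by
    by_contra hcon
    push Not at hcon
    exact hzC (h.mem_of hz1 hcon)
  obtain ⟨y, hy, hyz⟩ := this
  obtain ⟨x0, hx0, hmax⟩ := h.symm.compact.exists_isMaxOn
    (f := fun x : E n => ⟪x, z⟫ / (-⟪x, a⟫)) ⟨x, hx⟩ (by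
      apply ContinuousOn.div (by fun_prop) (by fun_prop)
      intro x hx
      exact (neg_pos.2 (ha' x hx)).ne')
  set l := ⟪x0, z⟫ / (-⟪x0, a⟫) with hl
  have hlx : ∀ x ∈ K, ⟪x, z⟫ / (-⟪x, a⟫) ≤ l := fun x hx => hmax hx
  have hl0 : 0 < l := lt_of_lt_of_le (div_pos hyz (neg_pos.2 (ha' y hy))) (hlx y hy)
  have hm0 : z + l • a ≠ 0 := by
    intro h0
    have h1 : ⟪z + l • a, a⟫ = 0 := by rw [h0, inner_zero_left]
    rw [inner_add_left, inner_smul_left, h.inner_self ha] at h1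
    simp only [conj_trivial] at h1
    linarith [hz a ha]
  have hmC := h.mem_normalize hm0 (fun x hx => by
    rw [inner_add_right, inner_smul_right]
    have := (div_le_iff₀ (neg_pos.2 (ha' x hx))).1 (hlx x hx)
    linarith)
  have hmx : ⟪x0, ‖z + l • a‖⁻¹ • (z + l • a)⟫ = 0 := by
    rw [inner_smul_right, inner_add_right, inner_smul_right]
    have : l * (-⟪x0, a⟫) = ⟪x0, z⟫ := by
      rw [hl]; exact div_mul_cancel₀ _ (neg_pos.2 (ha' x0 hx0)).ne'
    rw [← this]; ring
  obtain ⟨-, v, hv, hvt⟩ := hw _ hmC ⟨x0, hx0, hmx⟩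
  have hN : 0 < ‖z + l • a‖ := norm_pos_iff.2 hm0
  rw [inner_smul_right, inner_add_right, inner_smul_right, inv_mul_eq_iff_eq_mul₀ hN.ne'] at hvt
  have hN2 : ‖z + l • a‖ ≤ 1 + l := by
    refine (norm_add_le _ _).trans ?_
    rw [norm_smul, hz1, h.norm_one ha, Real.norm_of_nonneg hl0.le, mul_one]
  have e1 := hz v hv
  have e2 := hat v hv
  rw [real_inner_comm] at e1 e2
  nlinarith [mul_le_mul_of_nonneg_right hN2 ht0, mul_lt_mul_of_pos_left e2 hl0]

theorem opposite (h : DPair C K) {t : ℝ} (ht0 : 0 ≤ t) (hw : CDiam C K t) {p x : E n}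
    (hp : p ∈ C) (hx : x ∈ K) (hpx : ⟪x, p⟫ = 0) : t • p - √(1 - t ^ 2) • x ∈ C := by
  obtain ⟨ht1, ht2⟩ := h.bounds hw hp hx hpx
  have hxp : ⟪p, x⟫ = 0 := by rw [real_inner_comm]; exact hpx
  have hpp := h.inner_self hp
  have hxx := h.symm.inner_self hx
  have hr : √(1 - t ^ 2) ^ 2 = 1 - t ^ 2 := Real.sq_sqrt (by nlinarith)
  set r := √(1 - t ^ 2) with hrdef
  have hr0 : 0 ≤ r := Real.sqrt_nonneg _
  set F : Set (E n) := {z ∈ C | ⟪z, p⟫ = t} with hF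
  set G := closedConvexHull ℝ F with hG
  have hFn : ∀ z ∈ F, ‖z‖ = 1 := fun z hz => h.norm_one hz.1
  have hGball : G ⊆ Metric.closedBall 0 1 :=
    closedConvexHull_min (fun z hz => by simpa using (hFn z hz).le) (convex_closedBall _ _)
      Metric.isClosed_closedBall
  have hGc : IsCompact G :=
    (isCompact_closedBall (0 : E n) 1).of_isClosed_subset isClosed_closedConvexHull hGball
  have half : ∀ (c : E n) (s : ℝ), (∀ z ∈ F, s ≤ ⟪c, z⟫) → ∀ g ∈ G, s ≤ ⟪c, g⟫ := by
    intro c s hs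
    have : G ⊆ {g | s ≤ ⟪c, g⟫} := by
      apply closedConvexHull_min hs
      · exact convex_halfSpace_ge (f := fun g => ⟪c, g⟫)
          ⟨fun x y => inner_add_right _ _ _, fun a x => inner_smul_right _ _ _⟩ s
      · have hcont : Continuous fun g : E n => ⟪c, g⟫ := by fun_prop
        exact isClosed_le continuous_const hcont
    exact this
  set R : Set (E n) := (fun s : ℝ => t • p - s • x) '' Set.Ici 0 with hR
  have hmeet : ∃ τ : ℝ, 0 ≤ τ ∧ t • p - τ • x ∈ G := by
    by_contra hcon
    push Not at hcon
    have hdis : Disjoint R G := by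
      rw [Set.disjoint_left]
      rintro _ ⟨s, hs, rfl⟩
      exact hcon s hs
    have hRR : R = {y | ∃ s : ℝ, 0 ≤ s ∧ t • p - s • x = y} := by
      ext y; simp [hR]
    have hRconv : Convex ℝ R := by
      rintro _ ⟨s1, hs1, rfl⟩ _ ⟨s2, hs2, rfl⟩ α β hα hβ hαβ
      refine ⟨α * s1 + β * s2, ?_, ?_⟩
      · simp only [Set.mem_Ici] at *
        positivity
      · have : β = 1 - α := by linarith
        subst this
        simp only
        module
    have hRclosed : IsClosed R := by
      have : R = {y | y = t • p - (-⟪x, y⟫) • x ∧ 0 ≤ -⟪x, y⟫} := by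
        ext y
        constructor
        · rintro ⟨s, hs, rfl⟩
          have : -⟪x, t • p - s • x⟫ = s := by
            rw [inner_sub_right, inner_smul_right, inner_smul_right, hxx, hpx]; ring
          simp only [Set.mem_ofPred_eq]
          rw [this]
          exact ⟨rfl, hs⟩
        · rintro ⟨h1, h2⟩
          exact ⟨_, h2, h1.symm⟩
      rw [this]
      have c1 : Continuous fun y : E n => t • p - (-⟪x, y⟫) • x := by fun_prop
      have c2 : Continuous fun y : E n => -⟪x, y⟫ := by fun_prop
      exact (isClosed_eq continuous_id c1).inter (isClosed_le continuous_const c2)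
    obtain ⟨f, α, β, hfR, hαβ, hfG⟩ := geometric_hahn_banach_closed_compact hRconv hRclosed
      convex_closedConvexHull hGc hdis
    set a := (InnerProductSpace.toDual ℝ (E n)).symm f with ha
    have hfa : ∀ y, f y = ⟪a, y⟫ := fun y => by
      rw [ha, InnerProductSpace.toDual_symm_apply]
    have hax : 0 ≤ ⟪a, x⟫ := by
      by_contra hneg
      push Not at hneg
      have h0 := hfR _ ⟨0, by simp, rfl⟩
      have h1 := hfR _ ⟨(α - t * ⟪a, p⟫) / (-⟪a, x⟫), by
        rw [hfa, inner_sub_right, inner_smul_right, inner_smul_right] at h0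
        rw [Set.mem_Ici]
        exact div_nonneg (by linarith) (by linarith), rfl⟩
      simp only at h1
      rw [hfa, inner_sub_right, inner_smul_right, inner_smul_right] at h1
      have : (α - t * ⟪a, p⟫) / (-⟪a, x⟫) * ⟪a, x⟫ = -(α - t * ⟪a, p⟫) := by
        rw [div_neg, neg_mul, div_mul_cancel₀ _ hneg.ne]
      linarith
    have h0 := hfR _ ⟨0, by simp, rfl⟩
    simp only at h0
    rw [hfa, inner_sub_right, inner_smul_right, inner_smul_right] at h0
    set γ := β - t * ⟪a, p⟫ with hγ
    have hγ0 : 0 < γ := by rw [hγ]; linarith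
    -- the tangent direction
    set a' := a - ⟪a, p⟫ • p + (γ / 2) • x with ha'
    have ha'F : ∀ z ∈ F, γ / 2 ≤ ⟪a', z⟫ := by
      intro z hz
      have h1 := hfG z (subset_closedConvexHull hz)
      rw [hfa] at h1
      have h2 : ⟪p, z⟫ = t := by rw [real_inner_comm]; exact hz.2
      have h3 : -1 ≤ ⟪x, z⟫ := by
        have := abs_real_inner_le_norm x z
        rw [hFn z hz, h.symm.norm_one hx, mul_one] at this
        exact (abs_le.1 this).1
      rw [ha', inner_add_left, inner_sub_left, inner_smul_left, inner_smul_left, h2]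
      simp only [conj_trivial]
      nlinarith
    have ha'p : ⟪p, a'⟫ = 0 := by
      rw [ha', inner_add_right, inner_sub_right, inner_smul_right, inner_smul_right, hpp, hxp,
        real_inner_comm]
      ring
    have ha'x : 0 < ⟪x, a'⟫ := by
      rw [ha', inner_add_right, inner_sub_right, inner_smul_right, inner_smul_right, hpx, hxx,
        real_inner_comm]
      linarith
    -- points outside
    have hout : ∀ k : ℕ, ∃ z ∈ C, ⟪a', z⟫ ≤ t * ‖a'‖ ^ 2 * (1 / ((k : ℝ) + 1)) ∧
        ⟪p, z⟫ ≤ t * (1 + (1 / ((k : ℝ) + 1)) * ‖a'‖) + (1 / ((k : ℝ) + 1)) * ‖a'‖ := by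
      intro k
      set ε : ℝ := 1 / ((k : ℝ) + 1) with hε
      have hε0 : 0 < ε := by positivity
      set m := p + ε • a' with hm
      have hmx : 0 < ⟪x, m⟫ := by
        rw [hm, inner_add_right, inner_smul_right, hpx, zero_add]; positivity
      have hm0 : m ≠ 0 := by
        intro h0; rw [h0, inner_zero_right] at hmx; exact lt_irrefl _ hmx
      have hN : 0 < ‖m‖ := norm_pos_iff.2 hm0
      have hnot : ‖m‖⁻¹ • m ∉ C := by
        intro hmem
        have := h.nonpos hmem hx
        rw [inner_smul_right] at this
        have : 0 < ‖m‖⁻¹ * ⟪x, m⟫ := by positivity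
        linarith
      have : ∃ z ∈ C, ⟪‖m‖⁻¹ • m, z⟫ < t := by
        by_contra hcon
        push Not at hcon
        apply hnot
        apply h.complete ht0 hw hp hx hpx _ hcon
        rw [norm_smul, norm_inv, norm_norm, inv_mul_cancel₀ hN.ne']
      obtain ⟨z, hz, hzt⟩ := this
      rw [inner_smul_left] at hzt
      simp only [conj_trivial] at hzt
      rw [inv_mul_lt_iff₀ hN] at hzt
      have hm2 : ‖m‖ ^ 2 = 1 + ε ^ 2 * ‖a'‖ ^ 2 := by
        rw [hm, norm_add_sq_real, h.norm_one hp, inner_smul_right, ha'p, norm_smul,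
          Real.norm_of_nonneg hε0.le]
        ring
      have hmle : ‖m‖ ≤ 1 + ε ^ 2 * ‖a'‖ ^ 2 := by
        apply le_of_sq_le_sq _ (by positivity)
        rw [hm2]
        nlinarith [show 0 ≤ ε ^ 2 * ‖a'‖ ^ 2 by positivity]
      have hmle' : ‖m‖ ≤ 1 + ε * ‖a'‖ := by
        refine (norm_add_le _ _).trans ?_
        rw [norm_smul, h.norm_one hp, Real.norm_of_nonneg hε0.le]
      have hpz : t ≤ ⟪p, z⟫ := h.diam_le hw hp hx hpx hz hp
      have hza : -‖a'‖ ≤ ⟪a', z⟫ := by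
        have := abs_real_inner_le_norm a' z
        rw [h.norm_one hz, mul_one] at this
        exact (abs_le.1 this).1
      have hmz : ⟪m, z⟫ = ⟪p, z⟫ + ε * ⟪a', z⟫ := by
        rw [hm, inner_add_left, inner_smul_left]; simp
      rw [hmz] at hzt
      refine ⟨z, hz, ?_, ?_⟩
      · have h1 : ε * ⟪a', z⟫ ≤ ε * (t * ‖a'‖ ^ 2 * ε) := by
          nlinarith [mul_le_mul_of_nonneg_right hmle ht0]
        exact le_of_mul_le_mul_left h1 hε0
      · nlinarith [mul_le_mul_of_nonneg_right hmle' ht0, mul_le_mul_of_nonneg_left hza hε0.le]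
    choose z hzC hza hzp using hout
    obtain ⟨z0, hz0, φ, hφ, hlim⟩ := h.compact.tendsto_subseq hzC
    have hε : Filter.Tendsto (fun k : ℕ => 1 / (((φ k : ℕ) : ℝ) + 1)) Filter.atTop (nhds 0) :=
      tendsto_one_div_add_atTop_nhds_zero_nat.comp hφ.tendsto_atTop
    have l1 : ⟪a', z0⟫ ≤ t * ‖a'‖ ^ 2 * 0 := by
      refine le_of_tendsto_of_tendsto (Filter.Tendsto.inner tendsto_const_nhds hlim)
        (hε.const_mul _) (Filter.Eventually.of_forall fun k => hza (φ k))
    have l2 : ⟪p, z0⟫ ≤ t * (1 + 0 * ‖a'‖) + 0 * ‖a'‖ := by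
      refine le_of_tendsto_of_tendsto (Filter.Tendsto.inner tendsto_const_nhds hlim)
        ((((hε.mul_const _).const_add 1).const_mul t).add (hε.mul_const _))
        (Filter.Eventually.of_forall fun k => hzp (φ k))
    have l3 : t ≤ ⟪p, z0⟫ := h.diam_le hw hp hx hpx hz0 hp
    have hz0F : z0 ∈ F := ⟨hz0, by rw [real_inner_comm]; linarith⟩
    have := ha'F z0 hz0F
    linarith
  obtain ⟨τ, hτ0, hτ⟩ := hmeet
  have expand : ∀ s : ℝ, ‖t • p - s • x‖ ^ 2 = t ^ 2 + s ^ 2 := by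
    intro s
    rw [norm_sub_sq_real, inner_smul_left, inner_smul_right, hxp, norm_smul, norm_smul,
      h.norm_one hp, h.symm.norm_one hx, mul_one, mul_one, Real.norm_eq_abs, Real.norm_eq_abs,
      sq_abs, sq_abs]
    ring
  have hτr : τ ≤ r := by
    apply le_of_sq_le_sq _ hr0
    have h1 : ‖t • p - τ • x‖ ≤ 1 := by simpa using hGball hτ
    have h2 := expand τ
    nlinarith [norm_nonneg (t • p - τ • x)]
  apply h.complete ht0 hw hp hx hpx
  · have := expand r
    rw [hr] at this
    have h1 : ‖t • p - r • x‖ ^ 2 = 1 := by linarith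
    exact (pow_eq_one_iff_of_nonneg (norm_nonneg _) two_ne_zero).1 h1
  · intro c hc
    have h1 : t ≤ ⟪c, t • p - τ • x⟫ :=
      half c t (fun z hz => h.diam_le hw hp hx hpx hz.1 hc) _ hτ
    have h2 := h.nonpos hc hx
    rw [real_inner_comm] at h2
    rw [real_inner_comm, inner_sub_right, inner_smul_right, inner_smul_right]
    rw [inner_sub_right, inner_smul_right, inner_smul_right] at h1
    nlinarith

end DPair

namespace DPair

variable {n : ℕ} {C K : Set (E n)}

theorem min_pair_center (h : DPair C K) {p x : E n} (hp : p ∈ C) (hx : x ∈ K)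
    (hpx : ⟪x, p⟫ = 0) :
    ∃ x0 ∈ K, ∃ y0 ∈ K, ∃ c ∈ C, ∃ s : ℝ, 0 < s ∧ s ^ 2 = 1 - ⟪x0, y0⟫ ^ 2 ∧
      y0 = ⟪x0, y0⟫ • x0 - s • c ∧ ⟪x0, c⟫ = 0 ∧ ∀ u' ∈ K, ∀ v' ∈ K, ⟪x0, y0⟫ ≤ ⟪v', u'⟫ := by
  obtain ⟨y0, hy0, x0, hx0, hne, hmin⟩ := h.symm.min_pair hx hp (by rwa [real_inner_comm])
  have hc := h.symm.center_mem hy0 hx0 hne (fun y hy => hmin y0 hy0 y hy)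
  have h1 := h.symm.inner_gt hy0 hx0
  have h2 := h.symm.inner_lt hy0 hx0 hne
  have hs : 0 < 1 - ⟪x0, y0⟫ ^ 2 := by nlinarith
  refine ⟨x0, hx0, y0, hy0, _, hc, √(1 - ⟪x0, y0⟫ ^ 2), Real.sqrt_pos.2 hs,
    Real.sq_sqrt hs.le, ?_, h.symm.center_perp hx0 _, hmin⟩
  rw [smul_smul, mul_inv_cancel₀ (Real.sqrt_pos.2 hs).ne', one_smul]
  abel

/-- Bessel inequality for two orthogonal vectors. -/
theorem bessel {x c v : E n} (hx : ‖x‖ = 1) (hc : ‖c‖ = 1) (hv : ‖v‖ = 1) (h : ⟪x, c⟫ = 0) :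
    ⟪x, v⟫ ^ 2 + ⟪c, v⟫ ^ 2 ≤ 1 := by
  have := real_inner_self_nonneg (x := v - ⟪x, v⟫ • x - ⟪c, v⟫ • c)
  have h' : ⟪c, x⟫ = 0 := by rw [real_inner_comm]; exact h
  have e1 : ⟪v, x⟫ = ⟪x, v⟫ := real_inner_comm _ _
  have e2 : ⟪v, c⟫ = ⟪c, v⟫ := real_inner_comm _ _
  simp only [inner_sub_left, inner_sub_right, inner_smul_left, inner_smul_right,
    real_inner_self_eq_norm_sq, hx, hc, hv, h, h', conj_trivial, e1, e2] at this
  nlinarith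

theorem polar_diam (h : DPair C K) {t : ℝ} (hw : CDiam C K t) {p x : E n} (hp : p ∈ C)
    (hx : x ∈ K) (hpx : ⟪x, p⟫ = 0) {u v : E n} (hu : u ∈ K) (hv : v ∈ K) : -t ≤ ⟪v, u⟫ := by
  obtain ⟨ht1, ht2⟩ := h.bounds hw hp hx hpx
  obtain ⟨x0, hx0, y0, hy0, c, hc, s, hs, hs2, hy, hxc, hmin⟩ := h.min_pair_center hp hx hpx
  refine le_trans ?_ (hmin u hu v hv)
  set m := ⟪x0, y0⟫ with hm
  rcases lt_or_ge t 0 with ht | ht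
  · obtain ⟨-, v, hv, hvt⟩ := hw c hc ⟨x0, hx0, hxc⟩
    rw [real_inner_comm] at hvt
    have h1 := h.nonpos hv hx0
    have h2 := h.nonpos hv hy0
    have hb := bessel (h.symm.norm_one hx0) (h.norm_one hc) (h.norm_one hv) hxc
    rw [hy, inner_sub_left, inner_smul_left, inner_smul_left, hvt] at h2
    simp only [conj_trivial] at h2
    rw [hvt] at hb
    set q := ⟪x0, v⟫
    have h3 : m * q < 0 := by nlinarith
    have hm0 : 0 < m := by
      by_contra hcon
      push Not at hcon
      nlinarith
    have h4 : (s * t) ^ 2 ≤ (m * q) ^ 2 := by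
      rw [sq_le_sq, abs_of_neg (mul_neg_of_pos_of_neg hs ht), abs_of_neg h3]
      linarith
    have h5 : (1 - m ^ 2) * t ^ 2 ≤ m ^ 2 * q ^ 2 := by rw [← hs2]; nlinarith
    have h6 : t ^ 2 ≤ m ^ 2 := by nlinarith [mul_le_mul_of_nonneg_left hb (sq_nonneg m)]
    apply le_of_sq_le_sq _ hm0.le
    linarith
  · have hq := h.opposite ht hw hc hx0 hxc
    have hr : √(1 - t ^ 2) ^ 2 = 1 - t ^ 2 := Real.sq_sqrt (by nlinarith)
    have hr0 : 0 < √(1 - t ^ 2) := Real.sqrt_pos.2 (by nlinarith)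
    set r := √(1 - t ^ 2)
    have h2 := h.nonpos hq hy0
    have e1 : ⟪y0, c⟫ = -s := by
      rw [hy, inner_sub_left, inner_smul_left, inner_smul_left, hxc, h.inner_self hc]
      simp
    have e2 : ⟪y0, x0⟫ = m := real_inner_comm _ _
    rw [inner_sub_right, inner_smul_right, inner_smul_right, e1, e2] at h2
    rcases le_or_gt 0 m with h0 | h0
    · linarith
    · have h3 : r * (-m) ≤ t * s := by linarith
      have h4 : (r * (-m)) ^ 2 ≤ (t * s) ^ 2 :=
        pow_le_pow_left₀ (mul_nonneg hr0.le (by linarith)) h3 2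
      rw [mul_pow, mul_pow, hr, hs2] at h4
      have : (-m) ≤ t := by
        apply le_of_sq_le_sq _ ht
        nlinarith
      linarith

theorem cdiam_polar (h : DPair C K) {t : ℝ} (hw : CDiam C K t) : CDiam K C (-t) := by
  rintro x hx ⟨p, hp, hpx'⟩
  have hpx : ⟪x, p⟫ = 0 := by rw [real_inner_comm]; exact hpx'
  refine ⟨fun v hv => h.polar_diam hw hp hx hpx hx hv, ?_⟩
  obtain ⟨ht1, ht2⟩ := h.bounds hw hp hx hpx
  have hr : √(1 - t ^ 2) ^ 2 = 1 - t ^ 2 := Real.sq_sqrt (by nlinarith)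
  have hr0 : 0 < √(1 - t ^ 2) := Real.sqrt_pos.2 (by nlinarith)
  -- from a diametral partner of `p` we obtain a point of `K`
  have key : ∀ v ∈ C, ⟪v, p⟫ = t → (√(1 - t ^ 2))⁻¹ • (t • v - p) ∈ K := by
    intro v hv hvt
    have := h.center_mem hp hv (by
      rintro rfl
      rw [h.inner_self hp] at hvt
      exact ht2.ne' hvt) (fun y hy => by rw [hvt]; exact h.diam_le hw hp hx hpx hp hy)
    rwa [hvt] at this
  have val : ∀ v : E n, ⟪(√(1 - t ^ 2))⁻¹ • (t • v - p), x⟫ = (√(1 - t ^ 2))⁻¹ * (t * ⟪x, v⟫) := by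
    intro v
    rw [inner_smul_left, inner_sub_left, inner_smul_left, hpx', real_inner_comm]
    simp
  set r := √(1 - t ^ 2)
  rcases lt_or_ge t 0 with ht | ht
  · obtain ⟨-, v, hv, hvt⟩ := hw p hp ⟨x, hx, hpx⟩
    refine ⟨_, key v hv hvt, ?_⟩
    have h1 := h.polar_diam hw hp hx hpx hx (key v hv hvt)
    have hb := bessel (h.symm.norm_one hx) (h.norm_one hp) (h.norm_one hv) hpx
    rw [real_inner_comm] at hvt
    rw [hvt] at hb
    rw [val] at h1 ⊢
    rw [inv_mul_eq_iff_eq_mul₀ hr0.ne']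
    rw [le_inv_mul_iff₀ hr0] at h1
    set q := ⟪x, v⟫
    have h2 : -r ≤ q := (abs_le_of_sq_le_sq' (by rw [hr]; linarith) hr0.le).1
    have h3 : q ≤ -r := by nlinarith
    have : q = -r := le_antisymm h3 h2
    rw [this]; ring
  · have hq := h.opposite ht hw hp hx hpx
    refine ⟨_, key _ hq ?_, ?_⟩
    · rw [inner_sub_left, inner_smul_left, inner_smul_left, hpx, h.inner_self hp]
      simp
    · rw [val, inner_sub_right, inner_smul_right, inner_smul_right, hpx, h.symm.inner_self hx,
        inv_mul_eq_iff_eq_mul₀ hr0.ne']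
      change t * (t * 0 - r * 1) = r * -t
      ring

/-! ### Widths -/

theorem breadth_eq (h : DPair C K) {u v : E n} (hu : u ∈ C) (hv : v ∈ C) (hne : v ≠ u) :
    breadth u v = π - Real.arccos ⟪v, u⟫ := by
  have e : ⟪u, v⟫ = ⟪v, u⟫ := real_inner_comm _ _
  have h1 := h.inner_gt hu hv
  have h2 := h.inner_lt hu hv hne
  unfold breadth gdist luneFaceCenter
  rw [← Real.arccos_neg]
  congr 1
  rw [e]
  set t := ⟪v, u⟫ with ht
  have hpos : 0 < 1 - t ^ 2 := by nlinarith
  have hn : ∀ {a b : E n}, a ∈ C → b ∈ C → ⟪a, b⟫ = t → ‖t • a - b‖ = √(1 - t ^ 2) := by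
    intro a b ha hb hab
    rw [← Real.sqrt_sq (norm_nonneg (t • a - b))]
    congr 1
    rw [norm_sub_sq_real, norm_smul, h.norm_one ha, h.norm_one hb, inner_smul_left, hab,
      Real.norm_eq_abs, mul_one, sq_abs]
    simp only [conj_trivial]
    ring
  rw [hn hu hv e, hn hv hu rfl, inner_smul_left, inner_smul_right]
  simp only [inner_sub_left, inner_sub_right, inner_smul_left, inner_smul_right,
    h.inner_self hu, h.inner_self hv, e, ← ht, conj_trivial]
  have hs := Real.sq_sqrt hpos.le
  have hs0 := Real.sqrt_pos.2 hpos
  set s := √(1 - t ^ 2)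
  field_simp
  nlinarith

theorem widthAt_eq (h : DPair C K) {u x : E n} (hu : u ∈ C) (hx : x ∈ K) (hux : ⟪x, u⟫ = 0) :
    ∃ v ∈ C, (∀ y ∈ C, ⟪v, u⟫ ≤ ⟪y, u⟫) ∧ widthAt K u = π - Real.arccos ⟪v, u⟫ := by
  obtain ⟨v, hv, hmin⟩ := h.compact.exists_isMinOn (f := fun y : E n => ⟪y, u⟫) ⟨u, hu⟩
    (by fun_prop)
  have hmin' : ∀ y ∈ C, ⟪v, u⟫ ≤ ⟪y, u⟫ := fun y hy => hmin hy
  refine ⟨v, hv, hmin', ?_⟩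
  have hmemS : ∀ {y : E n}, y ∈ C → y ∈ unitSphere n := fun {y} hy => by
    simpa [unitSphere] using h.norm_one hy
  have hmemS' : ∀ {y : E n}, y ∈ K → y ∈ unitSphere n := fun {y} hy => by
    simpa [unitSphere] using h.symm.norm_one hy
  have hne : v ≠ u := by
    rintro rfl
    obtain ⟨a, ha, hap⟩ := h.exists_ne hu hx hux
    have h1 := hmin' a ha
    rw [h.inner_self hu] at h1
    exact absurd (h.inner_lt hu ha hap) (not_lt.2 h1)
  have hc := h.center_mem hu hv hne hmin'
  apply IsLeast.csInf_eq
  constructor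
  · refine ⟨v, ⟨hmemS hu, hmemS hv, hne.symm, ?_, ?_, ⟨x, hx, hmemS' hx, hux, h.nonpos hv hx⟩,
      ⟨_, hc, hmemS' hc, ?_, h.nonpos hu hc⟩⟩, (h.breadth_eq hu hv hne).symm⟩
    · intro huv
      have := h.inner_gt hu hv
      rw [huv, inner_neg_right, h.inner_self hv] at this
      exact lt_irrefl _ this
    · exact fun y hy => ⟨hmemS' hy, h.nonpos hu hy, h.nonpos hv hy⟩
    · rw [real_inner_comm]; exact h.center_perp hv _
  · rintro b ⟨y, ⟨_, hy1, hy2, _, hy3, _, _⟩, rfl⟩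
    have hyC : y ∈ C := h.mem_of (by simpa [unitSphere] using hy1) (fun z hz => (hy3 hz).2.2)
    rw [h.breadth_eq hu hyC hy2.symm]
    have := Real.arccos_le_arccos (hmin' y hyC)
    linarith

theorem forward (h : DPair C K) {w : ℝ} (hw : HasConstantWidth K w) :
    HasConstantWidth C (π - w) := by
  rintro x ⟨hx1, hx2, p, hp, hpx'⟩
  have hx : x ∈ K := h.symm.mem_of (by simpa [unitSphere] using hx1) hx2
  have hpx : ⟪x, p⟫ = 0 := by rw [real_inner_comm]; exact hpx'
  have hsup : ∀ u ∈ C, (∃ y ∈ K, ⟪y, u⟫ = 0) → IsSupportingSphere K u := fun u hu hy =>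
    ⟨by simpa [unitSphere] using h.norm_one hu, fun y hy => h.nonpos hu hy, hy⟩
  have hcd : CDiam C K (Real.cos (π - w)) := by
    rintro u hu ⟨y, hy, hyu⟩
    obtain ⟨v, hv, hmin, hval⟩ := h.widthAt_eq hu hy hyu
    rw [hw u (hsup u hu ⟨y, hy, hyu⟩)] at hval
    have hb := h.inner_gt hu hv
    have hb2 : ⟪v, u⟫ ≤ 1 := by
      have := real_inner_le_norm v u
      rwa [h.norm_one hu, h.norm_one hv, mul_one] at this
    have : Real.cos (π - w) = ⟪v, u⟫ := by
      rw [hval, sub_sub_cancel, Real.cos_arccos hb.le hb2]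
    rw [this]
    exact ⟨hmin, v, hv, rfl⟩
  have hw01 : 0 ≤ w ∧ w ≤ π := by
    obtain ⟨v, hv, hmin, hval⟩ := h.widthAt_eq hp hx hpx
    rw [hw p (hsup p hp ⟨x, hx, hpx⟩)] at hval
    have := Real.arccos_nonneg ⟪v, p⟫
    have := Real.arccos_le_pi ⟪v, p⟫
    constructor <;> linarith
  have hcd' := h.cdiam_polar hcd
  obtain ⟨h1, y, hy, hyt⟩ := hcd' x hx ⟨p, hp, hpx'⟩
  obtain ⟨v, hv, hmin, hval⟩ := h.symm.widthAt_eq hx hp hpx'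
  have : ⟪v, x⟫ = Real.cos w := by
    have e : -Real.cos (π - w) = Real.cos w := by rw [Real.cos_pi_sub, neg_neg]
    rw [e] at h1 hyt
    exact le_antisymm (hyt ▸ hmin y hy) (h1 v hv)
  rw [hval, this, Real.arccos_cos hw01.1 hw01.2]

end DPair

theorem seg_mem {n : ℕ} {K : Set (E n)} (hK : SConvex K) {x y : E n} (hx : x ∈ K) (hy : y ∈ K)
    {α β : ℝ} (hα : 0 < α) (hβ : 0 < β) (h0 : α • x + β • y ≠ 0) :
    ‖α • x + β • y‖⁻¹ • (α • x + β • y) ∈ K := by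
  have hx1 : ‖x‖ = 1 := by simpa [unitSphere] using hK.1 hx
  have hy1 : ‖y‖ = 1 := by simpa [unitSphere] using hK.1 hy
  have hy0 : y ≠ 0 := by rintro rfl; simp at hy1
  have hgd : ∀ a b : E n, ‖a‖ = 1 → ‖b‖ = 1 → gdist a b = InnerProductGeometry.angle a b := by
    intro a b ha hb
    simp [gdist, InnerProductGeometry.angle, ha, hb]
  have hz1 : ‖‖α • x + β • y‖⁻¹ • (α • x + β • y)‖ = 1 := by
    rw [norm_smul, norm_inv, norm_norm, inv_mul_cancel₀ (norm_ne_zero_iff.2 h0)]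
  have hNp : 0 < ‖α • x + β • y‖⁻¹ := inv_pos.2 (norm_pos_iff.2 h0)
  apply hK.2.2 x hx y hy
  refine ⟨by simpa [unitSphere] using hz1, ?_⟩
  rw [hgd _ _ hx1 hz1, hgd _ _ hz1 hy1, hgd _ _ hx1 hy1,
    InnerProductGeometry.angle_smul_right_of_pos _ _ hNp,
    InnerProductGeometry.angle_smul_left_of_pos _ _ hNp]
  have := InnerProductGeometry.angle_eq_angle_add_add_angle_add (α • x)
    (smul_ne_zero hβ.ne' hy0)
  rw [InnerProductGeometry.angle_smul_left_of_pos _ _ hα,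
    InnerProductGeometry.angle_smul_right_of_pos _ _ hβ,
    InnerProductGeometry.angle_smul_left_of_pos _ _ hα,
    InnerProductGeometry.angle_smul_left_of_pos _ _ hβ] at this
  rw [this, InnerProductGeometry.angle_comm y]

theorem bipolar {n : ℕ} {K : Set (E n)} (hK : SConvex K) (hKc : IsCompact K)
    (hne : K.Nonempty) : K = polar (polar K) := by
  have hS : ∀ {x : E n}, x ∈ K → ‖x‖ = 1 := fun {x} hx => by simpa [unitSphere] using hK.1 hx
  obtain ⟨e, he, hpos⟩ := hK.2.1
  apply Set.Subset.antisymm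
  · intro x hx
    refine ⟨hK.1 hx, fun u hu => ?_⟩
    rw [real_inner_comm]; exact hu.2 x hx
  · rintro y ⟨hy1, hy2⟩
    have hy1' : ‖y‖ = 1 := by simpa [unitSphere] using hy1
    by_contra hyK
    set Q : Set (E n) := {z | ∃ r : ℝ, 0 ≤ r ∧ ∃ x ∈ K, z = r • x} with hQ
    have hQconv : Convex ℝ Q := by
      rintro _ ⟨r1, hr1, x1, hx1, rfl⟩ _ ⟨r2, hr2, x2, hx2, rfl⟩ α β hα hβ hαβ
      rw [smul_smul, smul_smul]
      rcases (mul_nonneg hα hr1).eq_or_lt with h1 | h1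
      · rw [← h1, zero_smul, zero_add]
        exact ⟨_, mul_nonneg hβ hr2, x2, hx2, rfl⟩
      rcases (mul_nonneg hβ hr2).eq_or_lt with h2 | h2
      · rw [← h2, zero_smul, add_zero]
        exact ⟨_, mul_nonneg hα hr1, x1, hx1, rfl⟩
      have h0 : (α * r1) • x1 + (β * r2) • x2 ≠ 0 := by
        intro h0
        have h3 : ⟪e, (α * r1) • x1 + (β * r2) • x2⟫ = 0 := by rw [h0, inner_zero_right]
        rw [inner_add_right, inner_smul_right, inner_smul_right] at h3
        have := mul_pos h1 (hpos x1 hx1)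
        have := mul_pos h2 (hpos x2 hx2)
        linarith
      refine ⟨‖(α * r1) • x1 + (β * r2) • x2‖, norm_nonneg _, _,
        seg_mem hK hx1 hx2 h1 h2 h0, ?_⟩
      rw [smul_smul, mul_inv_cancel₀ (norm_ne_zero_iff.2 h0), one_smul]
    have hQclosed : IsClosed Q := by
      apply isClosed_of_closure_subset
      intro z hz
      rw [mem_closure_iff_seq_limit] at hz
      obtain ⟨s, hs, hlim⟩ := hz
      choose r hr x hx hsx using hs
      obtain ⟨x0, hx0, φ, hφ, hxl⟩ := hKc.tendsto_subseq hx
      have hrn : ∀ k, r k = ‖s k‖ := fun k => by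
        rw [hsx k, norm_smul, hS (hx k), mul_one, Real.norm_of_nonneg (hr k)]
      refine ⟨‖z‖, norm_nonneg _, x0, hx0, ?_⟩
      have l1 : Filter.Tendsto (fun k => s (φ k)) Filter.atTop (nhds z) :=
        hlim.comp hφ.tendsto_atTop
      have l2 : Filter.Tendsto (fun k => s (φ k)) Filter.atTop (nhds (‖z‖ • x0)) := by
        have := l1.norm.smul hxl
        refine this.congr fun k => ?_
        rw [Function.comp, ← hrn]
        exact (hsx (φ k)).symm
      exact tendsto_nhds_unique l1 l2
    have hyQ : y ∉ Q := by
      rintro ⟨r, hr, x, hx, hyx⟩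
      have : ‖y‖ = r := by rw [hyx, norm_smul, hS hx, mul_one, Real.norm_of_nonneg hr]
      rw [hy1'] at this
      rw [← this, one_smul] at hyx
      exact hyK (hyx ▸ hx)
    obtain ⟨f, s, hf, hsy⟩ := geometric_hahn_banach_closed_point hQconv hQclosed hyQ
    obtain ⟨x1, hx1⟩ := hne
    have hs0 : 0 < s := by
      have := hf 0 ⟨0, le_rfl, x1, hx1, by simp⟩
      simpa using this
    have hfK : ∀ x ∈ K, f x ≤ 0 := by
      intro x hx
      by_contra hcon
      push Not at hcon
      have := hf ((s / f x) • x) ⟨_, (div_pos hs0 hcon).le, x, hx, rfl⟩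
      rw [map_smul, smul_eq_mul, div_mul_cancel₀ _ hcon.ne'] at this
      exact lt_irrefl _ this
    set a := (InnerProductSpace.toDual ℝ (E n)).symm f with ha
    have hfa : ∀ y, f y = ⟪a, y⟫ := fun y => by
      rw [ha, InnerProductSpace.toDual_symm_apply]
    have hya : 0 < ⟪a, y⟫ := by rw [← hfa]; linarith
    have ha0 : a ≠ 0 := by
      intro h0; rw [h0, inner_zero_left] at hya; exact lt_irrefl _ hya
    have haN : 0 < ‖a‖ := norm_pos_iff.2 ha0
    have hmem : ‖a‖⁻¹ • a ∈ polar K := by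
      refine ⟨?_, fun x hx => ?_⟩
      · simp [unitSphere, norm_smul, haN.ne']
      · rw [inner_smul_right, real_inner_comm, ← hfa]
        exact mul_nonpos_of_nonneg_of_nonpos (by positivity) (hfK x hx)
    have := hy2 _ hmem
    rw [inner_smul_left] at this
    have : 0 < ‖a‖⁻¹ * ⟪a, y⟫ := by positivity
    simp only [conj_trivial] at *
    linarith

theorem dpair_of_body {n : ℕ} {K : Set (E n)} (hK : IsConvexBody K) : DPair (polar K) K := by
  obtain ⟨hc, hcomp, b, hbK, ε, hε, hball⟩ := hK
  refine ⟨rfl, bipolar hc hcomp ⟨b, hbK⟩, ?_, ?_⟩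
  · obtain ⟨e, he, hpos⟩ := hc.2.1
    have he1 : ‖e‖ = 1 := by simpa [unitSphere] using he
    have hneg : ∀ x ∈ K, ⟪x, -e⟫ < 0 := fun x hx => by
      rw [inner_neg_right, real_inner_comm]; linarith [hpos x hx]
    exact ⟨-e, ⟨by simpa [unitSphere] using he1, fun x hx => (hneg x hx).le⟩, hneg⟩
  · refine ⟨b, hbK, fun u hu => ?_⟩
    rw [real_inner_comm]
    refine lt_of_le_of_ne (hu.2 b hbK) fun h0 => ?_
    have hb1 : ‖b‖ = 1 := by simpa [unitSphere] using hc.1 hbK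
    have hu1 : ‖u‖ = 1 := by simpa [unitSphere] using hu.1
    set θ := min (ε / 2) 1 with hθ
    have hθ0 : 0 < θ := lt_min (by linarith) one_pos
    have hθ1 : θ ≤ 1 := min_le_right _ _
    have hθε : θ < ε := lt_of_le_of_lt (min_le_left _ _) (by linarith)
    have hθπ : θ < π := by linarith [Real.pi_gt_three]
    have hn : ‖Real.cos θ • b + Real.sin θ • u‖ = 1 := by
      have : ‖Real.cos θ • b + Real.sin θ • u‖ ^ 2 = 1 := by
        rw [norm_add_sq_real, inner_smul_left, inner_smul_right, h0, norm_smul, norm_smul, hb1,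
          hu1, mul_one, mul_one, Real.norm_eq_abs, Real.norm_eq_abs, sq_abs, sq_abs]
        simp
      exact (pow_eq_one_iff_of_nonneg (norm_nonneg _) two_ne_zero).1 this
    have hmem := hball (Real.cos θ • b + Real.sin θ • u) (by simpa [unitSphere] using hn) (by
      unfold gdist
      rw [inner_add_right, inner_smul_right, inner_smul_right, h0, real_inner_self_eq_norm_sq, hb1]
      rw [one_pow, mul_one, mul_zero, add_zero, Real.arccos_cos hθ0.le hθπ.le]
      exact hθε)
    have := hu.2 _ hmem
    rw [inner_add_left, inner_smul_left, inner_smul_left, h0, real_inner_self_eq_norm_sq, hu1] at this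
    simp only [conj_trivial] at this
    have := Real.sin_pos_of_pos_of_lt_pi hθ0 hθπ
    linarith

/-- Han–Wu: a spherical convex body is of constant width `w` iff its polar
body is of constant width `π - w`. -/
theorem constant_width_polar (n : ℕ) (K : Set (E n)) (hK : IsConvexBody K) (w : ℝ) :
    HasConstantWidth K w ↔ HasConstantWidth (polar K) (π - w) := by
  have h := dpair_of_body hK
  constructor
  · exact fun hw => h.forward hw
  · intro hw
    have := h.symm.forward hw
    rwa [sub_sub_cancel] at this
end
end
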